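/- (Global C² estimate for the Legendre transform.) For every K > 0 there exist constants ε > 0 and C₃₅ > 0, depending only on n, Ω, Ω̃, h, h̃, θ, θ̃ and K, with the following property. Let f ∈ 𝒜 with ‖f‖_{C²(Ω̄ × closure(Ω̃))} ≤ K satisfy condition (OSC), sup |D_x f| ≤ ε and sup |D_{xp} f| ≤ ε. Let u be a smooth uniformly convex solution of the second boundary value problem with data (f, c) and ũ its Legendre transform. Then max_{y ∈ closure(Ω̃)} ‖D²ũ(y)‖ ≤ C₃₅, where ‖·‖ denotes the operator norm. -/

import Mathlib

open Set MeasureTheory Matrix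
open scoped Topology RealInnerProductSpace NNReal

noncomputable section

abbrev Euc (n : ℕ) := EuclideanSpace ℝ (Fin n)

variable {n : ℕ}

/-- Hessian matrix of `u` at `x`. -/
def Hess (u : Euc n → ℝ) (x : Euc n) : Matrix (Fin n) (Fin n) ℝ :=
  fun i j => iteratedFDeriv ℝ 2 u x ![EuclideanSpace.single i 1, EuclideanSpace.single j 1]

/-- `A ≤ B` in the sense of symmetric matrices. -/
def MatLE (A B : Matrix (Fin n) (Fin n) ℝ) : Prop := (B - A).PosSemidef

/-- The Minkowski mean-curvature operator `div (∇u / √(1 - |∇u|²))`. -/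
def MinkDiv (u : Euc n → ℝ) (x : Euc n) : ℝ :=
  ∑ i, fderiv ℝ (fun y => (Real.sqrt (1 - ‖gradient u y‖ ^ 2))⁻¹ * gradient u y i) x
    (EuclideanSpace.single i 1)

/-- The Euclidean mean-curvature operator `div (∇u / √(1 + |∇u|²))`. -/
def EucDiv (u : Euc n → ℝ) (x : Euc n) : ℝ :=
  ∑ i, fderiv ℝ (fun y => (Real.sqrt (1 + ‖gradient u y‖ ^ 2))⁻¹ * gradient u y i) x
    (EuclideanSpace.single i 1)

/-- `S(p) = (1/v)(Iₙ + p pᵀ / v²)`, `v = √(1-|p|²)`. -/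
def Smat (p : Euc n) : Matrix (Fin n) (Fin n) ℝ :=
  (Real.sqrt (1 - ‖p‖ ^ 2))⁻¹ •
    ((1 : Matrix (Fin n) (Fin n) ℝ) +
      (1 - ‖p‖ ^ 2)⁻¹ • Matrix.vecMulVec (fun i => p i) (fun j => p j))

/-- `B(p) = Iₙ + p pᵀ / (v (1 + v))`, `v = √(1-|p|²)`. -/
def Bmat (p : Euc n) : Matrix (Fin n) (Fin n) ℝ :=
  (1 : Matrix (Fin n) (Fin n) ℝ) +
    (Real.sqrt (1 - ‖p‖ ^ 2) * (1 + Real.sqrt (1 - ‖p‖ ^ 2)))⁻¹ •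
      Matrix.vecMulVec (fun i => p i) (fun j => p j)

/-- `A(x) = (1/v)·B(∇u)·D²u·B(∇u)`: its eigenvalues are the principal curvatures. -/
def Amat (u : Euc n → ℝ) (x : Euc n) : Matrix (Fin n) (Fin n) ℝ :=
  (Real.sqrt (1 - ‖gradient u x‖ ^ 2))⁻¹ •
    (Bmat (gradient u x) * Hess u x * Bmat (gradient u x))

/-- supremum of the quadratic form of `A` over the unit sphere (the operator
norm / largest eigenvalue for a positive semidefinite symmetric `A`). -/
def quadSup (A : Matrix (Fin n) (Fin n) ℝ) : ℝ :=
  ⨆ ξ : Metric.sphere (0 : Euc n) 1,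
    (fun i => (ξ : Euc n) i) ⬝ᵥ A.mulVec (fun i => (ξ : Euc n) i)

/-- The domains `Ω = {h̃ > 0}`, `Ω̃ = {h > 0}` are bounded uniformly convex domains
with smooth boundary, described by the defining functions `h̃` and `h`. -/
def DomainSetup (Ω Ωt : Set (Euc n)) (ht h : Euc n → ℝ) (θt θ : ℝ) : Prop :=
  IsOpen Ω ∧ IsOpen Ωt ∧ Bornology.IsBounded Ω ∧ Bornology.IsBounded Ωt ∧
  Ω.Nonempty ∧ Ωt.Nonempty ∧
  ContDiff ℝ (⊤ : ℕ∞) ht ∧ ContDiff ℝ (⊤ : ℕ∞) h ∧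
  Ω = {x | 0 < ht x} ∧ Ωt = {y | 0 < h y} ∧
  (∀ x ∈ frontier Ω, ‖gradient ht x‖ = 1) ∧
  (∀ y ∈ frontier Ωt, ‖gradient h y‖ = 1) ∧
  0 < θt ∧ 0 < θ ∧
  (∀ x : Euc n, MatLE (Hess ht x) ((-θt) • (1 : Matrix (Fin n) (Fin n) ℝ))) ∧
  (∀ y : Euc n, MatLE (Hess h y) ((-θ) • (1 : Matrix (Fin n) (Fin n) ℝ)))

/-- `f ∈ 𝒜`: `f` is `C²` on `Ω̄ × closure Ω̃` and concave in `x`. -/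
def InA (Ω Ωt : Set (Euc n)) (f : Euc n × Euc n → ℝ) : Prop :=
  ContDiffOn ℝ 2 f (closure Ω ×ˢ closure Ωt) ∧
  ∀ p ∈ closure Ωt, ConcaveOn ℝ (closure Ω) (fun x => f (x, p))

/-- Condition (OSC): `osc f ≤ (n/2)(|Ω̃|/|Ω|)^{1/n}`. -/
def OSCcond (Ω Ωt : Set (Euc n)) (f : Euc n × Euc n → ℝ) : Prop :=
  ∀ x ∈ closure Ω, ∀ y ∈ closure Ω, ∀ p ∈ closure Ωt, ∀ q ∈ closure Ωt,
    |f (x, p) - f (y, q)| ≤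
      ((n : ℝ) / 2) * ((volume Ωt).toReal / (volume Ω).toReal) ^ ((1 : ℝ) / n)

/-- `‖f‖_{C²(Ω̄ × closure Ω̃)} ≤ K`. -/
def C2Bound (Ω Ωt : Set (Euc n)) (f : Euc n × Euc n → ℝ) (K : ℝ) : Prop :=
  ContDiffOn ℝ 2 f (closure Ω ×ˢ closure Ωt) ∧
  ∀ z ∈ closure Ω ×ˢ closure Ωt,
    |f z| ≤ K ∧ ‖fderiv ℝ f z‖ ≤ K ∧ ‖iteratedFDeriv ℝ 2 f z‖ ≤ K

/-- `sup |D_x f| ≤ ε` on `Ω̄ × closure Ω̃`. -/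
def DxBound (Ω Ωt : Set (Euc n)) (f : Euc n × Euc n → ℝ) (ε : ℝ) : Prop :=
  ∀ x ∈ closure Ω, ∀ p ∈ closure Ωt, ‖fderiv ℝ (fun x' => f (x', p)) x‖ ≤ ε

/-- `sup |D_{xp} f| ≤ ε` on `Ω̄ × closure Ω̃`. -/
def DxpBound (Ω Ωt : Set (Euc n)) (f : Euc n × Euc n → ℝ) (ε : ℝ) : Prop :=
  ∀ x ∈ closure Ω, ∀ p ∈ closure Ωt,
    ‖fderiv ℝ (fun p' => fderiv ℝ (fun x' => f (x', p')) x) p‖ ≤ ε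

/-- A strictly convex solution of the second boundary value problem. -/
def IsStrictSol (Ω Ωt : Set (Euc n)) (f : Euc n × Euc n → ℝ) (c : ℝ) (u : Euc n → ℝ) : Prop :=
  ContDiffOn ℝ 2 u (closure Ω) ∧
  (∀ x ∈ closure Ω, (Hess u x).PosDef) ∧
  (∀ x ∈ closure Ω, ‖gradient u x‖ < 1) ∧
  (∀ x ∈ Ω, MinkDiv u x = f (x, gradient u x) + c) ∧
  gradient u '' Ω = Ωt

/-- A smooth uniformly convex solution of the second boundary value problem. -/
def IsSmoothSol (Ω Ωt : Set (Euc n)) (f : Euc n × Euc n → ℝ) (c : ℝ) (u : Euc n → ℝ) : Prop :=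
  ContDiffOn ℝ (⊤ : ℕ∞) u (closure Ω) ∧
  (∃ δ : ℝ, 0 < δ ∧ ∀ x ∈ closure Ω, MatLE (δ • (1 : Matrix (Fin n) (Fin n) ℝ)) (Hess u x)) ∧
  (∀ x ∈ closure Ω, ‖gradient u x‖ < 1) ∧
  (∀ x ∈ Ω, MinkDiv u x = f (x, gradient u x) + c) ∧
  gradient u '' Ω = Ωt

/-- A uniformly convex `C^{2}` solution of the second boundary value problem. -/
def IsUCSol (Ω Ωt : Set (Euc n)) (f : Euc n × Euc n → ℝ) (c : ℝ) (u : Euc n → ℝ) : Prop :=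
  ContDiffOn ℝ 2 u (closure Ω) ∧
  (∃ δ : ℝ, 0 < δ ∧ ∀ x ∈ closure Ω, MatLE (δ • (1 : Matrix (Fin n) (Fin n) ℝ)) (Hess u x)) ∧
  (∀ x ∈ closure Ω, ‖gradient u x‖ < 1) ∧
  (∀ x ∈ Ω, MinkDiv u x = f (x, gradient u x) + c) ∧
  gradient u '' Ω = Ωt

/-- A uniformly convex `C^{4,α}` solution of the second boundary value problem
for the Minkowski mean-curvature operator. -/
def IsC4Sol (Ω Ωt : Set (Euc n)) (f : Euc n × Euc n → ℝ) (c : ℝ) (u : Euc n → ℝ)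
    (α : ℝ) : Prop :=
  ContDiffOn ℝ 4 u (closure Ω) ∧
  (∃ C : ℝ≥0, HolderOnWith C (Real.toNNReal α) (fun x => iteratedFDeriv ℝ 4 u x) (closure Ω)) ∧
  (∃ δ : ℝ, 0 < δ ∧ ∀ x ∈ closure Ω, MatLE (δ • (1 : Matrix (Fin n) (Fin n) ℝ)) (Hess u x)) ∧
  (∀ x ∈ closure Ω, ‖gradient u x‖ < 1) ∧
  (∀ x ∈ Ω, MinkDiv u x = f (x, gradient u x) + c) ∧
  gradient u '' Ω = Ωt

/-- A uniformly convex `C^{4,α}` solution of the second boundary value problem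
for the Euclidean mean-curvature operator. -/
def IsC4SolE (Ω Ωt : Set (Euc n)) (f : Euc n × Euc n → ℝ) (c : ℝ) (u : Euc n → ℝ)
    (α : ℝ) : Prop :=
  ContDiffOn ℝ 4 u (closure Ω) ∧
  (∃ C : ℝ≥0, HolderOnWith C (Real.toNNReal α) (fun x => iteratedFDeriv ℝ 4 u x) (closure Ω)) ∧
  (∃ δ : ℝ, 0 < δ ∧ ∀ x ∈ closure Ω, MatLE (δ • (1 : Matrix (Fin n) (Fin n) ℝ)) (Hess u x)) ∧
  (∀ x ∈ Ω, EucDiv u x = f (x, gradient u x) + c) ∧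
  gradient u '' Ω = Ωt

/-- `ũ` is the Legendre transform of `u`. -/
def IsLegendre (Ω Ωt : Set (Euc n)) (u ut : Euc n → ℝ) : Prop :=
  ContDiffOn ℝ (⊤ : ℕ∞) ut (closure Ωt) ∧
  (∀ x ∈ closure Ω, ut (gradient u x) = ⟪x, gradient u x⟫ - u x) ∧
  (∀ x ∈ closure Ω, gradient ut (gradient u x) = x) ∧
  (∀ x ∈ closure Ω, Hess ut (gradient u x) = (Hess u x)⁻¹)

section SecondDerivativeTest

variable {V : Type*} [NormedAddCommGroup V] [NormedSpace ℝ V]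

lemma IsLocalMin.second_deriv_nonneg {φ φ' : ℝ → ℝ} {a q : ℝ} (hmin : IsLocalMin φ a)
    (h1 : ∀ᶠ t in 𝓝 a, HasDerivAt φ (φ' t) t) (h2 : HasDerivAt φ' q a) : 0 ≤ q := by
  by_contra! hq
  have hd : deriv φ =ᶠ[𝓝 a] φ' := h1.mono fun t ht => ht.deriv
  have hdd : deriv (deriv φ) a = q := by rw [hd.deriv_eq, h2.deriv]
  have hmax : IsLocalMax φ a :=
    isLocalMax_of_deriv_deriv_neg (hdd ▸ hq) hmin.deriv_eq_zero h1.self_of_nhds.continuousAt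
  have hconst : φ =ᶠ[𝓝 a] fun _ => φ a := by
    filter_upwards [hmin, hmax] with t ht1 ht2 using le_antisymm ht2 ht1
  have h0 : deriv φ =ᶠ[𝓝 a] fun _ => 0 := by
    filter_upwards [hconst.eventuallyEq_nhds] with t ht
    rw [ht.deriv_eq]; simp
  rw [h0.deriv_eq] at hdd
  simp at hdd
  linarith

lemma IsLocalMin.second_fderiv_nonneg {φ : V → ℝ} {φ' : V → V →L[ℝ] ℝ}
    {φ'' : V →L[ℝ] V →L[ℝ] ℝ} {y : V} (hmin : IsLocalMin φ y)
    (h1 : ∀ᶠ z in 𝓝 y, HasFDerivAt φ (φ' z) z) (h2 : HasFDerivAt φ' φ'' y) (v : V) :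
    0 ≤ φ'' v v := by
  have hline : ∀ t : ℝ, HasDerivAt (fun t : ℝ => y + t • v) v t := fun t => by
    simpa using ((hasDerivAt_id t).smul_const v).const_add y
  have hcont : Filter.Tendsto (fun t : ℝ => y + t • v) (𝓝 0) (𝓝 y) := by
    simpa using (hline 0).continuousAt.tendsto
  refine IsLocalMin.second_deriv_nonneg (φ := fun t : ℝ => φ (y + t • v))
    (φ' := fun t => φ' (y + t • v) v) (a := 0) ?_ ?_ ?_
  · have := hcont.eventually hmin
    simpa [IsLocalMin, IsMinFilter] using this
  · filter_upwards [hcont.eventually h1] with t ht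
    exact ht.comp_hasDerivAt t (hline t)
  · have h2' : HasFDerivAt φ' φ'' (y + (0 : ℝ) • v) := by simpa using h2
    have := h2'.comp_hasDerivAt (0 : ℝ) (hline 0)
    simpa using this.clm_apply (hasDerivAt_const (0 : ℝ) v)

lemma IsLocalMax.second_fderiv_nonpos {φ : V → ℝ} {φ' : V → V →L[ℝ] ℝ}
    {φ'' : V →L[ℝ] V →L[ℝ] ℝ} {y : V} (hmax : IsLocalMax φ y)
    (h1 : ∀ᶠ z in 𝓝 y, HasFDerivAt φ (φ' z) z) (h2 : HasFDerivAt φ' φ'' y) (v : V) :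
    φ'' v v ≤ 0 := by
  have := IsLocalMin.second_fderiv_nonneg (φ := fun z => -φ z) (φ' := fun z => -φ' z)
    (φ'' := -φ'') hmax.neg (h1.mono fun z hz => hz.neg) h2.neg v
  simpa using this

end SecondDerivativeTest

section ConvexDomain

variable {E : Type*} [NormedAddCommGroup E] [InnerProductSpace ℝ E]

/-- `D = {h > 0}` is a bounded domain with `h` uniformly concave, `N` being the gradient of `h`,
of unit length on the boundary. -/
structure ConvexDomain (D : Set E) (h : E → ℝ) (N : E → E) (θ : ℝ) : Prop where
  pos : 0 < θ
  bounded : Bornology.IsBounded D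
  nonempty : D.Nonempty
  eq_setOf : D = {y | 0 < h y}
  contDiff_grad : ContDiff ℝ 2 N
  hasFDerivAt : ∀ y, HasFDerivAt h (innerSL ℝ (N y)) y
  norm_grad : ∀ y ∈ frontier D, ‖N y‖ = 1
  concave : ∀ y v, ⟪fderiv ℝ N y v, v⟫ ≤ -θ * ‖v‖ ^ 2

namespace ConvexDomain

variable {D : Set E} {h : E → ℝ} {N : E → E} {θ : ℝ}

lemma hasFDerivAt_grad (hD : ConvexDomain D h N θ) (y : E) : HasFDerivAt N (fderiv ℝ N y) y :=
  (hD.contDiff_grad.differentiable (by norm_num) y).hasFDerivAt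

lemma continuous (hD : ConvexDomain D h N θ) : Continuous h :=
  continuous_iff_continuousAt.2 fun y => (hD.hasFDerivAt y).continuousAt

lemma isOpen (hD : ConvexDomain D h N θ) : IsOpen D := by
  rw [hD.eq_setOf]; exact isOpen_lt continuous_const hD.continuous

lemma mem_iff (hD : ConvexDomain D h N θ) {y : E} : y ∈ D ↔ 0 < h y := by
  rw [hD.eq_setOf]; rfl

lemma concaveOn (hD : ConvexDomain D h N θ) : ConcaveOn ℝ univ h := by
  refine ⟨convex_univ, fun x _ y _ a b ha hb hab => ?_⟩
  have hline : ∀ t : ℝ, HasDerivAt (fun t : ℝ => x + t • (y - x)) (y - x) t := fun t => by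
    simpa using ((hasDerivAt_id t).smul_const (y - x)).const_add x
  have h1 : ∀ t : ℝ, HasDerivAt (fun t : ℝ => h (x + t • (y - x)))
      ⟪N (x + t • (y - x)), y - x⟫ t := fun t =>
    (hD.hasFDerivAt _).comp_hasDerivAt t (hline t)
  have h2 : ∀ t : ℝ, HasDerivAt (fun t : ℝ => ⟪N (x + t • (y - x)), y - x⟫)
      ⟪fderiv ℝ N (x + t • (y - x)) (y - x), y - x⟫ t := fun t => by
    simpa using ((hD.hasFDerivAt_grad _).comp_hasDerivAt t (hline t)).inner ℝ
      (hasDerivAt_const t (y - x))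
  have hd1 : deriv (fun t : ℝ => h (x + t • (y - x)))
      = fun t : ℝ => ⟪N (x + t • (y - x)), y - x⟫ := funext fun t => (h1 t).deriv
  have hconc : ConcaveOn ℝ univ (fun t : ℝ => h (x + t • (y - x))) := by
    refine concaveOn_of_deriv2_nonpos convex_univ
      (fun t _ => (h1 t).continuousAt.continuousWithinAt)
      (fun t _ => (h1 t).differentiableAt.differentiableWithinAt)
      (fun t _ => ?_) (fun t _ => ?_)
    · rw [hd1]; exact (h2 t).differentiableAt.differentiableWithinAt
    · simp only [Function.iterate_succ, Function.iterate_zero, Function.comp_apply, id_eq]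
      rw [hd1, (h2 t).deriv]
      have := hD.concave (x + t • (y - x)) (y - x)
      have h0 := mul_nonneg hD.pos.le (sq_nonneg ‖y - x‖)
      linarith
  have := hconc.2 (mem_univ (0 : ℝ)) (mem_univ (1 : ℝ)) ha hb hab
  have e : x + b • (y - x) = a • x + b • y := by
    rw [← eq_sub_iff_add_eq] at hab; subst hab; module
  simpa [e] using this

lemma convex (hD : ConvexDomain D h N θ) : Convex ℝ D := by
  have := hD.concaveOn.convex_gt 0
  rw [hD.eq_setOf]; simpa using this

lemma mem_closure_iff (hD : ConvexDomain D h N θ) {y : E} : y ∈ closure D ↔ 0 ≤ h y := by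
  constructor
  · intro hy
    have : closure D ⊆ {y | 0 ≤ h y} := closure_minimal
      (fun z hz => (hD.mem_iff.1 hz).le) (isClosed_le continuous_const hD.continuous)
    exact this hy
  · intro hy
    obtain ⟨z, hz⟩ := hD.nonempty
    have hcont : Filter.Tendsto (fun t : ℝ => (1 - t) • y + t • z) (𝓝[>] 0) (𝓝 y) := by
      have : ContinuousAt (fun t : ℝ => (1 - t) • y + t • z) 0 := by fun_prop
      simpa using this.tendsto.mono_left nhdsWithin_le_nhds
    refine mem_closure_of_tendsto hcont ?_
    filter_upwards [Ioo_mem_nhdsGT (zero_lt_one' ℝ)] with t ht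
    rw [hD.mem_iff]
    have := hD.concaveOn.2 (mem_univ y) (mem_univ z) (sub_nonneg.2 ht.2.le) ht.1.le
      (sub_add_cancel 1 t)
    simp only [smul_eq_mul] at this
    have h1 := mul_nonneg (sub_nonneg.2 ht.2.le) hy
    have h2 := mul_pos ht.1 (hD.mem_iff.1 hz)
    linarith

lemma mem_frontier_iff (hD : ConvexDomain D h N θ) {y : E} : y ∈ frontier D ↔ h y = 0 := by
  rw [hD.isOpen.frontier_eq, mem_sdiff, hD.mem_closure_iff, hD.mem_iff, not_lt]
  exact ⟨fun H => le_antisymm H.2 H.1, fun H => ⟨H.ge, H.le⟩⟩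

lemma mem_or_mem_frontier (hD : ConvexDomain D h N θ) {y : E} (hy : y ∈ closure D) :
    y ∈ D ∨ y ∈ frontier D := by
  rw [hD.mem_closure_iff] at hy
  rw [hD.mem_iff, hD.mem_frontier_iff]
  exact hy.lt_or_eq.imp id Eq.symm

lemma isCompact_closure [FiniteDimensional ℝ E] (hD : ConvexDomain D h N θ) :
    IsCompact (closure D) :=
  haveI := FiniteDimensional.proper_real E
  hD.bounded.isCompact_closure

lemma isCompact_frontier [FiniteDimensional ℝ E] (hD : ConvexDomain D h N θ) :
    IsCompact (frontier D) :=
  hD.isCompact_closure.of_isClosed_subset isClosed_frontier frontier_subset_closure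

lemma nonempty_frontier [Nontrivial E] (hD : ConvexDomain D h N θ) : (frontier D).Nonempty := by
  rw [nonempty_frontier_iff]
  refine ⟨hD.nonempty, fun hu => ?_⟩
  exact NormedSpace.unbounded_univ ℝ E (hu ▸ hD.bounded)

/-- At a boundary minimum the derivative is a nonnegative multiple of the inner normal. -/
lemma exists_eq_smul_of_isMinOn (hD : ConvexDomain D h N θ) {ψ : E → ℝ} {ψ' : E →L[ℝ] ℝ} {y : E}
    (hy : y ∈ frontier D) (hmin : IsMinOn ψ (closure D) y)
    (hψ : HasFDerivWithinAt ψ ψ' (closure D) y) :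
    ∃ κ : ℝ, 0 ≤ κ ∧ ∀ v, ψ' v = κ * ⟪N y, v⟫ := by
  have hN : ⟪N y, N y⟫ = 1 := by
    rw [real_inner_self_eq_norm_sq, hD.norm_grad y hy]; norm_num
  have key : ∀ v, 0 < ⟪N y, v⟫ → 0 ≤ ψ' v := by
    intro v hv
    have hline : HasDerivAt (fun t : ℝ => h (y + t • v)) ⟪N y, v⟫ 0 := by
      have h0 : HasFDerivAt h (innerSL ℝ (N y)) (y + (0 : ℝ) • v) := by
        simpa using hD.hasFDerivAt y
      have hl : HasDerivAt (fun t : ℝ => y + t • v) v 0 := by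
        simpa using ((hasDerivAt_id (0 : ℝ)).smul_const v).const_add y
      exact h0.comp_hasDerivAt (0 : ℝ) hl
    have hpos : ∀ᶠ t in 𝓝[>] (0 : ℝ), 0 < h (y + t • v) := by
      have hs := hline.tendsto_slope.mono_left
        (nhdsWithin_mono (0 : ℝ) (fun t (ht : t ∈ Ioi (0 : ℝ)) => (ne_of_gt ht : t ≠ 0)))
      filter_upwards [hs.eventually (lt_mem_nhds hv), self_mem_nhdsWithin] with t ht ht0
      have ht0' : (0 : ℝ) < t := ht0
      rw [slope_def_field] at ht
      simp only [zero_smul, add_zero, sub_zero, hD.mem_frontier_iff.1 hy] at ht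
      exact (div_pos_iff_of_pos_right ht0').1 ht
    obtain ⟨t, ht, ht0⟩ := (hpos.and self_mem_nhdsWithin).exists
    have ht0' : (0 : ℝ) < t := ht0
    have hmem : t • v ∈ posTangentConeAt (closure D) y := by
      refine mem_posTangentConeAt_of_segment_subset ?_
      exact hD.convex.closure.segment_subset (frontier_subset_closure hy)
        (subset_closure (hD.mem_iff.2 ht))
    have := hmin.localize.hasFDerivWithinAt_nonneg hψ hmem
    rw [map_smul, smul_eq_mul] at this
    exact nonneg_of_mul_nonneg_right this ht0'
  have key' : ∀ v, 0 ≤ ⟪N y, v⟫ → 0 ≤ ψ' v := by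
    intro v hv
    refine le_of_forall_pos_lt_add fun e he => ?_
    by_contra! hcon
    have hpos : (0 : ℝ) < |ψ' (N y)| + 1 := by positivity
    have h1 := key (v + (e / 2 / (|ψ' (N y)| + 1)) • N y) (by
      rw [inner_add_right, inner_smul_right, hN, mul_one]; positivity)
    rw [map_add, map_smul, smul_eq_mul] at h1
    have h2 : e / 2 / (|ψ' (N y)| + 1) * ψ' (N y) ≤ e / 2 := by
      rw [div_mul_eq_mul_div, div_le_iff₀ hpos]
      have := le_abs_self (ψ' (N y))
      nlinarith
    linarith
  refine ⟨ψ' (N y), key' _ (hN ▸ zero_le_one), fun v => ?_⟩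
  have h0 : ⟪N y, v - ⟪N y, v⟫ • N y⟫ = 0 := by
    rw [inner_sub_right, inner_smul_right, hN]; ring
  have h1 := key' _ h0.ge
  have h2 := key' (-(v - ⟪N y, v⟫ • N y)) (by rw [inner_neg_right, h0, neg_zero])
  rw [map_neg] at h2
  rw [map_sub, map_smul, smul_eq_mul] at h1 h2
  linarith

end ConvexDomain

end ConvexDomain

section DualEstimate

set_option maxSynthPendingDepth 5

variable {E : Type*} [NormedAddCommGroup E] [InnerProductSpace ℝ E] {ι : Type*} [Fintype ι]

/-- The structural information on a dual solution used in the a priori estimate: `X` is the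
gradient of the dual potential, `A` its Hessian, `T` its third derivative. At each `y ∈ D` the
linearized operator is `φ ↦ ∑ₖ D²φ(bₖ, bₖ) + Dφ(g)`. -/
structure DualSolution (Ω D : Set E) (ε l Cb Cr C₁ C₂ : ℝ) (X : E → E) (A : E → E →L[ℝ] E)
    (T : E → E →L[ℝ] E →L[ℝ] E) (b : E → ι → E) (g : E → E) : Prop where
  hasFDeriv_X : ∀ y ∈ closure D, HasFDerivWithinAt X (A y) (closure D) y
  hasFDeriv_A : ∀ y ∈ closure D, HasFDerivWithinAt A (T y) (closure D) y
  differentiableAt_T : ∀ y ∈ D, DifferentiableAt ℝ T y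
  symm_A : ∀ y ∈ closure D, ∀ v w, ⟪A y v, w⟫ = ⟪A y w, v⟫
  pos_A : ∀ y ∈ closure D, ∀ v, v ≠ 0 → 0 < ⟪A y v, v⟫
  symm_T : ∀ y ∈ closure D, ∀ v w, T y v w = T y w v
  symm_T_inner : ∀ y ∈ closure D, ∀ u v w, ⟪T y u v, w⟫ = ⟪T y u w, v⟫
  mapsTo : ∀ y ∈ D, X y ∈ Ω
  mapsTo_frontier : ∀ y ∈ frontier D, X y ∈ frontier Ω
  norm_b : ∀ y ∈ D, ∀ k, ‖b y k‖ ≤ Cb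
  le_sum : ∀ y ∈ D, l ≤ ∑ k, ‖b y k‖ ^ 2
  norm_g : ∀ y ∈ D, ‖g y‖ ≤ ε
  norm_A_b : ∀ y ∈ D, ∀ k, ‖A y (b y k)‖ ≤ Cr
  drift : ∀ y ∈ D, ‖∑ k, T y (b y k) (b y k) + A y (g y)‖ ≤ C₁
  hess : ∀ y ∈ D, ∀ ξ, ‖ξ‖ ≤ 1 → -(C₂ + 2 * ε * ‖A y ξ‖) ≤
    ∑ k, ⟪fderiv ℝ T y (b y k) (b y k) ξ, ξ⟫ + ⟪T y (g y) ξ, ξ⟫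

/-- Comparison with the barrier `h`. -/
lemma ConvexDomain.le_add_barrier [FiniteDimensional ℝ E] {D : Set E} {h : E → ℝ} {N : E → E}
    {θ : ℝ} (hD : ConvexDomain D h N θ) {b : E → ι → E} {g : E → E} {μ : ℝ} (hμ : 0 < μ)
    (hbar : ∀ y ∈ D, ∑ k, ⟪fderiv ℝ N y (b y k), b y k⟫ + ⟪N y, g y⟫ ≤ -μ)
    {φ : E → ℝ} {φ' : E → E →L[ℝ] ℝ} {φ'' : E → E →L[ℝ] E →L[ℝ] ℝ} {C m : ℝ}
    (hC0 : 0 ≤ C) (hcont : ContinuousOn φ (closure D)) (h1 : ∀ y ∈ D, HasFDerivAt φ (φ' y) y)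
    (h2 : ∀ y ∈ D, HasFDerivAt φ' (φ'' y) y)
    (hL : ∀ y ∈ D, -C ≤ ∑ k, φ'' y (b y k) (b y k) + φ' y (g y))
    (hm : ∀ y ∈ frontier D, φ y ≤ m) :
    ∀ y ∈ closure D, φ y ≤ m + (C + 1) / μ * h y := by
  set a := (C + 1) / μ with ha
  have haμ : a * μ = C + 1 := div_mul_cancel₀ _ hμ.ne'
  obtain ⟨y₀, hy₀, hmax⟩ := hD.isCompact_closure.exists_isMaxOn hD.nonempty.closure
    (hcont.sub (hD.continuous.continuousOn.const_smul a))
  have hle : φ y₀ - a * h y₀ ≤ m := by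
    rcases hD.mem_or_mem_frontier hy₀ with hy | hy
    · exfalso
      have hloc : IsLocalMax (fun y => φ y - a * h y) y₀ :=
        hmax.isLocalMax (Filter.mem_of_superset (hD.isOpen.mem_nhds hy) subset_closure)
      have hN2 : HasFDerivAt (fun z => innerSL ℝ (N z))
          ((innerSL ℝ : E →L[ℝ] E →L[ℝ] ℝ).comp (fderiv ℝ N y₀)) y₀ :=
        (innerSL ℝ : E →L[ℝ] E →L[ℝ] ℝ).hasFDerivAt.comp y₀ (hD.hasFDerivAt_grad y₀)
      have hd1 : ∀ z ∈ D, HasFDerivAt (fun y => φ y - a * h y) (φ' z - a • innerSL ℝ (N z)) z :=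
        fun z hz => (h1 z hz).sub ((hD.hasFDerivAt z).const_mul a)
      have hg := hloc.hasFDerivAt_eq_zero (hd1 y₀ hy)
      have hsec : ∀ v, φ'' y₀ v v - a * ⟪fderiv ℝ N y₀ v, v⟫ ≤ 0 := fun v => by
        have := hloc.second_fderiv_nonpos
          (Filter.eventually_of_mem (hD.isOpen.mem_nhds hy) hd1)
          ((h2 y₀ hy).sub (hN2.const_smul a)) v
        simpa using this
      have hg' : φ' y₀ (g y₀) - a * ⟪N y₀, g y₀⟫ = 0 := by
        simpa using congrArg (fun F => F (g y₀)) hg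
      have hsum : ∑ k, φ'' y₀ (b y₀ k) (b y₀ k)
          - a * ∑ k, ⟪fderiv ℝ N y₀ (b y₀ k), b y₀ k⟫ ≤ 0 := by
        rw [Finset.mul_sum, ← Finset.sum_sub_distrib]
        exact Finset.sum_nonpos fun k _ => hsec _
      have hC := hL y₀ hy
      have hb := hbar y₀ hy
      have ha0 : 0 ≤ a := by positivity
      nlinarith [mul_le_mul_of_nonneg_left hb ha0]
    · have := hm y₀ hy
      rw [hD.mem_frontier_iff.1 hy]; linarith
  intro y hy
  have h3 : φ y - a * h y ≤ φ y₀ - a * h y₀ := hmax hy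
  linarith

section Composition

variable {P : Type*} [NormedAddCommGroup P] [NormedSpace ℝ P]

/-- The derivative at `y` of `y ↦ (p, X y, y)` when `X` has derivative `A`. -/
def graphDeriv (P : Type*) [NormedAddCommGroup P] [NormedSpace ℝ P] (A : E →L[ℝ] E) :
    E →L[ℝ] P × E × E :=
  ((ContinuousLinearMap.inr ℝ P (E × E)).comp (ContinuousLinearMap.inl ℝ E E)).comp A +
    (ContinuousLinearMap.inr ℝ P (E × E)).comp (ContinuousLinearMap.inr ℝ E E)

@[simp] lemma graphDeriv_apply (A : E →L[ℝ] E) (v : E) : graphDeriv P A v = (0, A v, v) := by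
  simp [graphDeriv]

lemma norm_graphDeriv_apply_le (A : E →L[ℝ] E) (v : E) :
    ‖graphDeriv P A v‖ ≤ ‖A v‖ + ‖v‖ := by
  rw [graphDeriv_apply, Prod.norm_def, Prod.norm_def]
  simp only [norm_zero]
  exact max_le (by positivity) (max_le (by simp) (by simp))

lemma hasFDerivWithinAt_graph {X : E → E} {A : E →L[ℝ] E} {s : Set E} {y : E}
    (hX : HasFDerivWithinAt X A s y) (p : P) :
    HasFDerivWithinAt (fun z => (p, X z, z)) (graphDeriv P A) s y := by
  have := (hasFDerivWithinAt_const p y s).prodMk (hX.prodMk (hasFDerivWithinAt_id y s))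
  have e : graphDeriv P A = (0 : E →L[ℝ] P).prod (A.prod (ContinuousLinearMap.id ℝ E)) :=
    ContinuousLinearMap.ext fun v => by simp
  rw [e]
  exact this

lemma hasFDerivWithinAt_comp_graph {G : P × E × E → ℝ} (hG : ContDiff ℝ 2 G) {X : E → E}
    {A : E →L[ℝ] E} {s : Set E} {y : E} (hX : HasFDerivWithinAt X A s y) (p : P) :
    HasFDerivWithinAt (fun z => G (p, X z, z))
      ((fderiv ℝ G (p, X y, y)).comp (graphDeriv P A)) s y :=
  (hG.differentiable (by norm_num) _).hasFDerivAt.comp_hasFDerivWithinAt y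
    (hasFDerivWithinAt_graph hX p)

/-- The second derivative of `y ↦ G (p, X y, y)`. -/
def graphHess (G : P × E × E → ℝ) (p : P) (X : E → E) (A : E → E →L[ℝ] E)
    (T : E → E →L[ℝ] E →L[ℝ] E) (y : E) : E →L[ℝ] E →L[ℝ] ℝ :=
  (ContinuousLinearMap.compL ℝ E (P × E × E) ℝ (fderiv ℝ G (p, X y, y))).comp
      ((ContinuousLinearMap.compL ℝ E E (P × E × E)
        ((ContinuousLinearMap.inr ℝ P (E × E)).comp (ContinuousLinearMap.inl ℝ E E))).comp (T y)) +
    ((ContinuousLinearMap.compL ℝ E (P × E × E) ℝ).flip (graphDeriv P (A y))).comp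
      ((fderiv ℝ (fderiv ℝ G) (p, X y, y)).comp (graphDeriv P (A y)))

lemma graphHess_apply (G : P × E × E → ℝ) (p : P) (X : E → E) (A : E → E →L[ℝ] E)
    (T : E → E →L[ℝ] E →L[ℝ] E) (y v : E) :
    graphHess G p X A T y v v = fderiv ℝ G (p, X y, y) (0, T y v v, 0) +
      fderiv ℝ (fderiv ℝ G) (p, X y, y) (graphDeriv P (A y) v) (graphDeriv P (A y) v) := by
  simp [graphHess]

lemma hasFDerivAt_comp_graph_deriv {G : P × E × E → ℝ} (hG : ContDiff ℝ 2 G) {X : E → E}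
    {A : E → E →L[ℝ] E} {T : E → E →L[ℝ] E →L[ℝ] E} {y : E} (hX : HasFDerivAt X (A y) y)
    (hA : HasFDerivAt A (T y) y) (p : P) :
    HasFDerivAt (fun z => (fderiv ℝ G (p, X z, z)).comp (graphDeriv P (A z)))
      (graphHess G p X A T y) y := by
  have hG' : HasFDerivAt (fderiv ℝ G) (fderiv ℝ (fderiv ℝ G) (p, X y, y)) (p, X y, y) :=
    ((hG.fderiv_right (m := 1) (by norm_num)).differentiable (by norm_num) _).hasFDerivAt
  have hc := hG'.comp y (hasFDerivWithinAt_univ.1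
    (hasFDerivWithinAt_graph hX.hasFDerivWithinAt p))
  have hd : HasFDerivAt (fun z => graphDeriv P (A z)) ((ContinuousLinearMap.compL ℝ E E (P × E × E)
      ((ContinuousLinearMap.inr ℝ P (E × E)).comp (ContinuousLinearMap.inl ℝ E E))).comp (T y)) y :=
    (((ContinuousLinearMap.compL ℝ E E (P × E × E)
      ((ContinuousLinearMap.inr ℝ P (E × E)).comp
        (ContinuousLinearMap.inl ℝ E E))).hasFDerivAt).comp y hA).add_const _
  exact hc.clm_comp hd

lemma exists_fderiv_bound [FiniteDimensional ℝ E] {Ω D : Set E} (hΩ : IsCompact (closure Ω))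
    (hD : IsCompact (closure D)) {G : P × E × E → ℝ} (hG : ContDiff ℝ 2 G) {K : Set P}
    (hK : IsCompact K) :
    ∃ C, 0 ≤ C ∧ ∀ p ∈ K, ∀ x ∈ closure Ω, ∀ y ∈ closure D,
      ‖fderiv ℝ G (p, x, y)‖ ≤ C ∧ ‖fderiv ℝ (fderiv ℝ G) (p, x, y)‖ ≤ C := by
  have hcomp := hK.prod (hΩ.prod hD)
  have hG1 : ContDiff ℝ 1 (fderiv ℝ G) := hG.fderiv_right (by norm_num)
  obtain ⟨C₁, h₁⟩ := hcomp.exists_bound_of_continuousOn (hG1.continuous.continuousOn)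
  obtain ⟨C₂, h₂⟩ := hcomp.exists_bound_of_continuousOn
    ((hG1.continuous_fderiv (by norm_num)).continuousOn)
  refine ⟨max 0 (max C₁ C₂), le_max_left _ _, fun p hp x hx y hy => ⟨?_, ?_⟩⟩
  · exact (h₁ (p, x, y) ⟨hp, hx, hy⟩).trans ((le_max_left _ _).trans (le_max_right _ _))
  · exact (h₂ (p, x, y) ⟨hp, hx, hy⟩).trans ((le_max_right _ _).trans (le_max_right _ _))

end Composition

namespace DualSolution

variable {Ω D : Set E} {ε l Cb Cr C₁ C₂ : ℝ} {X : E → E} {A : E → E →L[ℝ] E}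
  {T : E → E →L[ℝ] E →L[ℝ] E} {b : E → ι → E} {g : E → E}

lemma hasFDerivAt_X (S : DualSolution Ω D ε l Cb Cr C₁ C₂ X A T b g) (ho : IsOpen D) {y : E}
    (hy : y ∈ D) : HasFDerivAt X (A y) y :=
  (S.hasFDeriv_X y (subset_closure hy)).hasFDerivAt
    (Filter.mem_of_superset (ho.mem_nhds hy) subset_closure)

lemma hasFDerivAt_A (S : DualSolution Ω D ε l Cb Cr C₁ C₂ X A T b g) (ho : IsOpen D) {y : E}
    (hy : y ∈ D) : HasFDerivAt A (T y) y :=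
  (S.hasFDeriv_A y (subset_closure hy)).hasFDerivAt
    (Filter.mem_of_superset (ho.mem_nhds hy) subset_closure)

lemma mapsTo_closure (S : DualSolution Ω D ε l Cb Cr C₁ C₂ X A T b g) (ho : IsOpen D) {y : E}
    (hy : y ∈ closure D) : X y ∈ closure Ω := by
  by_cases h : y ∈ D
  · exact subset_closure (S.mapsTo y h)
  · exact frontier_subset_closure (S.mapsTo_frontier y (ho.frontier_eq ▸ ⟨hy, h⟩))

/-- The linearized operator is bounded on smooth functions of `(X y, y)`. -/
lemma abs_operator_comp_le {P : Type*} [NormedAddCommGroup P] [NormedSpace ℝ P]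
    (S : DualSolution Ω D ε l Cb Cr C₁ C₂ X A T b g)
    {G : P × E × E → ℝ} {p : P} {C : ℝ} (hC : 0 ≤ C) {y : E} (hy : y ∈ D)
    (h₁ : ‖fderiv ℝ G (p, X y, y)‖ ≤ C) (h₂ : ‖fderiv ℝ (fderiv ℝ G) (p, X y, y)‖ ≤ C) :
    |∑ k, graphHess G p X A T y (b y k) (b y k) +
      (fderiv ℝ G (p, X y, y)).comp (graphDeriv P (A y)) (g y)| ≤
        C * (C₁ + ε + Fintype.card ι * (Cr + Cb) ^ 2) := by
  set G' := fderiv ℝ G (p, X y, y)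
  set G'' := fderiv ℝ (fderiv ℝ G) (p, X y, y)
  have e : ∑ k, graphHess G p X A T y (b y k) (b y k) + G'.comp (graphDeriv P (A y)) (g y) =
      G' (0, ∑ k, T y (b y k) (b y k) + A y (g y), g y) +
      ∑ k, G'' (graphDeriv P (A y) (b y k)) (graphDeriv P (A y) (b y k)) := by
    have e1 : ((0, ∑ k, T y (b y k) (b y k) + A y (g y), g y) : P × E × E) =
        ∑ k, ((0, T y (b y k) (b y k), 0) : P × E × E) + (0, A y (g y), g y) := by
      simp [Prod.ext_iff, Prod.fst_sum, Prod.snd_sum]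
    rw [e1, map_add, map_sum]
    simp only [graphHess_apply, Finset.sum_add_distrib, ContinuousLinearMap.comp_apply,
      graphDeriv_apply]
    ring
  have hb : ∀ k, ‖graphDeriv P (A y) (b y k)‖ ≤ Cr + Cb := fun k =>
    (norm_graphDeriv_apply_le _ _).trans (add_le_add (S.norm_A_b y hy k) (S.norm_b y hy k))
  have h3 : |G' (0, ∑ k, T y (b y k) (b y k) + A y (g y), g y)| ≤ C * (C₁ + ε) := by
    refine (G'.le_opNorm _).trans (mul_le_mul h₁ ?_ (norm_nonneg _) hC)
    rw [Prod.norm_def, Prod.norm_def]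
    have hd := S.drift y hy
    have hg := S.norm_g y hy
    have hd0 := (norm_nonneg _).trans hd
    have hg0 := (norm_nonneg _).trans hg
    simp only [norm_zero]
    exact max_le (by positivity) (max_le (by linarith) (by linarith))
  have h4 : ∀ k, |G'' (graphDeriv P (A y) (b y k)) (graphDeriv P (A y) (b y k))| ≤
      C * (Cr + Cb) ^ 2 := fun k => by
    have hk := hb k
    have h0 := norm_nonneg (graphDeriv P (A y) (b y k))
    have hCC : 0 ≤ C * (Cr + Cb) := mul_nonneg hC (h0.trans hk)
    calc _ ≤ ‖G''‖ * ‖graphDeriv P (A y) (b y k)‖ * ‖graphDeriv P (A y) (b y k)‖ :=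
          G''.le_opNorm₂ _ _
      _ ≤ C * (Cr + Cb) * (Cr + Cb) := by gcongr
      _ = _ := by ring
  have h5 : |∑ k, G'' (graphDeriv P (A y) (b y k)) (graphDeriv P (A y) (b y k))| ≤
      Fintype.card ι * (C * (Cr + Cb) ^ 2) := by
    refine (Finset.abs_sum_le_sum_abs _ _).trans ((Finset.sum_le_sum fun k _ => h4 k).trans ?_)
    simp
  rw [e]
  refine (abs_add_le _ _).trans ((add_le_add h3 h5).trans_eq ?_)
  ring

lemma barrier {h : E → ℝ} {N : E → E} {θ CN : ℝ} (hD : ConvexDomain D h N θ)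
    (S : DualSolution Ω D ε l Cb Cr C₁ C₂ X A T b g)
    (hN : ∀ y ∈ closure D, ‖N y‖ ≤ CN) (hε : ε * CN ≤ θ * l / 2) :
    ∀ y ∈ D, ∑ k, ⟪fderiv ℝ N y (b y k), b y k⟫ + ⟪N y, g y⟫ ≤ -(θ * l / 2) := by
  intro y hy
  have h1 : ∑ k, ⟪fderiv ℝ N y (b y k), b y k⟫ ≤ -θ * l := by
    refine (Finset.sum_le_sum fun k _ => hD.concave y (b y k)).trans ?_
    rw [← Finset.mul_sum]
    nlinarith [S.le_sum y hy, hD.pos]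
  have h2 : ⟪N y, g y⟫ ≤ CN * ε :=
    (real_inner_le_norm _ _).trans (mul_le_mul (hN y (subset_closure hy)) (S.norm_g y hy)
      (norm_nonneg _) ((norm_nonneg _).trans (hN y (subset_closure hy))))
  nlinarith

/-- If `y ↦ G (p, X y, y)` is bounded above by `m` on the boundary, it is bounded by `m` plus a
multiple of `h` inside. -/
lemma comp_le_add_barrier [FiniteDimensional ℝ E] {P : Type*} [NormedAddCommGroup P]
    [NormedSpace ℝ P] {h : E → ℝ} {N : E → E} {θ μ : ℝ} (hD : ConvexDomain D h N θ)
    (S : DualSolution Ω D ε l Cb Cr C₁ C₂ X A T b g) (hμ : 0 < μ)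
    (hbar : ∀ y ∈ D, ∑ k, ⟪fderiv ℝ N y (b y k), b y k⟫ + ⟪N y, g y⟫ ≤ -μ)
    {G : P × E × E → ℝ} (hG : ContDiff ℝ 2 G) {p : P} {C m : ℝ} (hC : 0 ≤ C)
    (hbound : ∀ y ∈ D, |∑ k, graphHess G p X A T y (b y k) (b y k) +
      (fderiv ℝ G (p, X y, y)).comp (graphDeriv P (A y)) (g y)| ≤ C)
    (hm : ∀ y ∈ frontier D, G (p, X y, y) ≤ m) :
    ∀ y ∈ closure D, G (p, X y, y) ≤ m + (C + 1) / μ * h y := by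
  have ho := hD.isOpen
  refine hD.le_add_barrier hμ hbar (φ := fun y => G (p, X y, y))
    (φ' := fun y => (fderiv ℝ G (p, X y, y)).comp (graphDeriv P (A y)))
    (φ'' := graphHess G p X A T) hC
    (fun y hy => (hasFDerivWithinAt_comp_graph hG (S.hasFDeriv_X y hy) p).continuousWithinAt)
    (fun y hy => hasFDerivWithinAt_univ.1 (hasFDerivWithinAt_comp_graph hG
      (S.hasFDerivAt_X ho hy).hasFDerivWithinAt p))
    (fun y hy => hasFDerivAt_comp_graph_deriv hG (S.hasFDerivAt_X ho hy) (S.hasFDerivAt_A ho hy) p)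
    (fun y hy => (abs_le.1 (hbound y hy)).1) hm

end DualSolution


end DualEstimate

section Obliqueness

set_option maxSynthPendingDepth 5

variable {E : Type*} [NormedAddCommGroup E] [InnerProductSpace ℝ E] {ι : Type*} [Fintype ι]

namespace ConvexDomain

variable {D : Set E} {h : E → ℝ} {N : E → E} {θ : ℝ}

lemma contDiff (hD : ConvexDomain D h N θ) : ContDiff ℝ 2 h := by
  have e : fderiv ℝ h = fun y => innerSL ℝ (N y) := funext fun y => (hD.hasFDerivAt y).fderiv
  have : ContDiff ℝ (1 + 1) h := by
    rw [contDiff_succ_iff_fderiv]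
    refine ⟨fun y => (hD.hasFDerivAt y).differentiableAt, by simp, ?_⟩
    rw [e]
    exact (innerSL ℝ : E →L[ℝ] E →L[ℝ] ℝ).contDiff.comp (hD.contDiff_grad.of_le (by norm_num))
  rwa [one_add_one_eq_two] at this

end ConvexDomain

namespace DualSolution

variable {Ω D : Set E} {ε l Cb Cr C₁ C₂ : ℝ} {h ht : E → ℝ} {N Nt : E → E} {θ θt CN : ℝ}

/-- Uniform comparison for smooth functions of `(X y, y)`. -/
lemma exists_comp_le [FiniteDimensional ℝ E] {P : Type*} [NormedAddCommGroup P] [NormedSpace ℝ P]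
    (hΩ : ConvexDomain Ω ht Nt θt) (hD : ConvexDomain D h N θ) (hl : 0 < l)
    (hN : ∀ y ∈ closure D, ‖N y‖ ≤ CN) (hε : ε * CN ≤ θ * l / 2)
    {G : P × E × E → ℝ} (hG : ContDiff ℝ 2 G) {K : Set P} (hK : IsCompact K) :
    ∃ a, 0 ≤ a ∧ ∀ ⦃X : E → E⦄ ⦃A : E → E →L[ℝ] E⦄ ⦃T : E → E →L[ℝ] E →L[ℝ] E⦄ ⦃b : E → ι → E⦄
      ⦃g : E → E⦄, DualSolution Ω D ε l Cb Cr C₁ C₂ X A T b g → ∀ p ∈ K, ∀ m,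
      (∀ y ∈ frontier D, G (p, X y, y) ≤ m) → ∀ y ∈ closure D, G (p, X y, y) ≤ m + a * h y := by
  obtain ⟨C, hC, hCb⟩ := exists_fderiv_bound hΩ.isCompact_closure hD.isCompact_closure hG hK
  have hμ : 0 < θ * l / 2 := by have := hD.pos; positivity
  set C' := |C * (C₁ + ε + Fintype.card ι * (Cr + Cb) ^ 2)|
  refine ⟨(C' + 1) / (θ * l / 2), by positivity, fun X A T b g S p hp m hm => ?_⟩
  refine S.comp_le_add_barrier hD hμ (S.barrier hD hN hε) hG (abs_nonneg _) (fun y hy => ?_) hm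
  have := hCb p hp (X y) (subset_closure (S.mapsTo y hy)) y (subset_closure hy)
  exact (S.abs_operator_comp_le hC hy this.1 this.2).trans (le_abs_self _)

lemma exists_le_mul_barrier [FiniteDimensional ℝ E]
    (hΩ : ConvexDomain Ω ht Nt θt) (hD : ConvexDomain D h N θ) (hl : 0 < l)
    (hN : ∀ y ∈ closure D, ‖N y‖ ≤ CN) (hε : ε * CN ≤ θ * l / 2) :
    ∃ a, 0 ≤ a ∧ ∀ ⦃X : E → E⦄ ⦃A : E → E →L[ℝ] E⦄ ⦃T : E → E →L[ℝ] E →L[ℝ] E⦄ ⦃b : E → ι → E⦄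
      ⦃g : E → E⦄, DualSolution Ω D ε l Cb Cr C₁ C₂ X A T b g →
      ∀ y ∈ closure D, ht (X y) ≤ a * h y := by
  have hG : ContDiff ℝ 2 (fun z : ℝ × E × E => ht z.2.1) :=
    hΩ.contDiff.comp (contDiff_fst.comp contDiff_snd)
  obtain ⟨a, ha, H⟩ := exists_comp_le (ι := ι) (Cb := Cb) (Cr := Cr) (C₁ := C₁) (C₂ := C₂)
    hΩ hD hl hN hε hG (isCompact_singleton (x := (0 : ℝ)))
  refine ⟨a, ha, fun X A T b g S y hy => ?_⟩
  simpa using H S 0 rfl 0 (fun z hz => (hΩ.mem_frontier_iff.1 (S.mapsTo_frontier z hz)).le) y hy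

variable {X : E → E} {A : E → E →L[ℝ] E} {T : E → E →L[ℝ] E →L[ℝ] E} {b : E → ι → E} {g : E → E}

/-- At a boundary point `A` maps the normal of `Ω` to a multiple of the normal of `D`. -/
lemma exists_normal_eq (hΩ : ConvexDomain Ω ht Nt θt) (hD : ConvexDomain D h N θ)
    (S : DualSolution Ω D ε l Cb Cr C₁ C₂ X A T b g) {a : ℝ}
    (ha : ∀ y ∈ closure D, ht (X y) ≤ a * h y) {y : E} (hy : y ∈ frontier D) :
    ∃ r, 0 < r ∧ r ≤ a ∧ A y (Nt (X y)) = r • N y ∧ 0 < ⟪N y, Nt (X y)⟫ := by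
  have hyc := frontier_subset_closure hy
  have hXy := S.mapsTo_frontier y hy
  have hβ : ‖Nt (X y)‖ = 1 := hΩ.norm_grad _ hXy
  have hν : ‖N y‖ = 1 := hD.norm_grad _ hy
  have h0 : ht (X y) = 0 := hΩ.mem_frontier_iff.1 hXy
  have h0' : h y = 0 := hD.mem_frontier_iff.1 hy
  have hd : HasFDerivWithinAt (fun z => ht (X z)) ((innerSL ℝ (Nt (X y))).comp (A y))
      (closure D) y := (hΩ.hasFDerivAt (X y)).comp_hasFDerivWithinAt y (S.hasFDeriv_X y hyc)
  obtain ⟨r, hr, hrv⟩ := hD.exists_eq_smul_of_isMinOn hy (ψ := fun z => ht (X z))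
    (fun z hz => by
      have := hΩ.mem_closure_iff.1 (S.mapsTo_closure hD.isOpen hz)
      simpa [h0] using this) hd
  obtain ⟨q, hq, hqv⟩ := hD.exists_eq_smul_of_isMinOn hy (ψ := fun z => a * h z - ht (X z))
    (fun z hz => by
      have := ha z hz
      simpa [h0, h0'] using this)
    (((hD.hasFDerivAt y).hasFDerivWithinAt.const_mul a).sub hd)
  have hAβ : A y (Nt (X y)) = r • N y := by
    refine ext_inner_right ℝ fun v => ?_
    have := hrv v
    simp only [ContinuousLinearMap.comp_apply, innerSL_apply_apply] at this
    rw [S.symm_A y hyc, real_inner_comm, this, inner_smul_left]; simp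
  have hpos : 0 < r * ⟪N y, Nt (X y)⟫ := by
    have := S.pos_A y hyc (Nt (X y)) (fun h => by simp [h] at hβ)
    rwa [hAβ, inner_smul_left] at this
  have hr0 : 0 < r := hr.lt_of_ne (fun h => by simp [← h] at hpos)
  refine ⟨r, hr0, ?_, hAβ, (mul_pos_iff_of_pos_left hr0).1 hpos⟩
  have h1 := hqv (N y)
  have h2 := hrv (N y)
  have hνν : ⟪N y, N y⟫ = 1 := by rw [real_inner_self_eq_norm_sq, hν]; norm_num
  simp only [ContinuousLinearMap.comp_apply, innerSL_apply_apply, hνν, mul_one,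
    _root_.sub_apply, _root_.smul_apply, smul_eq_mul] at h1 h2
  linarith

/-- Uniform obliqueness. -/
lemma exists_oblique [FiniteDimensional ℝ E] [Nontrivial E]
    (hΩ : ConvexDomain Ω ht Nt θt) (hD : ConvexDomain D h N θ) (hl : 0 < l)
    (hN : ∀ y ∈ closure D, ‖N y‖ ≤ CN) (hε : ε * CN ≤ θ * l / 2) :
    ∃ c, 0 < c ∧ ∀ ⦃X : E → E⦄ ⦃A : E → E →L[ℝ] E⦄ ⦃T : E → E →L[ℝ] E →L[ℝ] E⦄ ⦃b : E → ι → E⦄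
      ⦃g : E → E⦄, DualSolution Ω D ε l Cb Cr C₁ C₂ X A T b g →
      ∀ y ∈ frontier D, c ≤ ⟪N y, Nt (X y)⟫ := by
  have hG : ContDiff ℝ 2 (fun z : ℝ × E × E => -⟪N z.2.2, Nt z.2.1⟫) :=
    ((hD.contDiff_grad.comp (contDiff_snd.comp contDiff_snd)).inner ℝ
      (hΩ.contDiff_grad.comp (contDiff_fst.comp contDiff_snd))).neg
  obtain ⟨a₁, ha₁, H₁⟩ := exists_le_mul_barrier (ι := ι) (Cb := Cb) (Cr := Cr) (C₁ := C₁)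
    (C₂ := C₂) hΩ hD hl hN hε
  obtain ⟨a, ha, H⟩ := exists_comp_le (ι := ι) (Cb := Cb) (Cr := Cr) (C₁ := C₁) (C₂ := C₂)
    hΩ hD hl hN hε hG (isCompact_singleton (x := (0 : ℝ)))
  have hθ := hD.pos
  refine ⟨θ / (a + 1), by positivity, fun X A T b g S => ?_⟩
  have hd : ∀ y ∈ closure D, HasFDerivWithinAt (fun z => ⟪N z, Nt (X z)⟫) _ (closure D) y :=
    fun y hy => ((hD.hasFDerivAt_grad y).hasFDerivWithinAt).inner ℝ
      ((hΩ.hasFDerivAt_grad (X y)).comp_hasFDerivWithinAt y (S.hasFDeriv_X y hy))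
  have hcont : ContinuousOn (fun z => ⟪N z, Nt (X z)⟫) (frontier D) := fun y hy =>
    (hd y (frontier_subset_closure hy)).continuousWithinAt.mono frontier_subset_closure
  obtain ⟨y₀, hy₀, hmin⟩ := hD.isCompact_frontier.exists_isMinOn hD.nonempty_frontier hcont
  suffices hs : θ / (a + 1) ≤ ⟪N y₀, Nt (X y₀)⟫ from fun y hy => hs.trans (hmin hy)
  have hcomp := H S 0 rfl (-⟪N y₀, Nt (X y₀)⟫) (fun y hy => neg_le_neg (hmin hy))
  have hh : h y₀ = 0 := hD.mem_frontier_iff.1 hy₀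
  have hy₀c := frontier_subset_closure hy₀
  obtain ⟨κ, hκ, hκv⟩ := hD.exists_eq_smul_of_isMinOn hy₀
    (ψ := fun z => ⟪N z, Nt (X z)⟫ + a * h z)
    (fun z hz => by
      have := hcomp z hz
      simp only [mem_ofPred_eq, hh, mul_zero, add_zero]
      linarith)
    ((hd y₀ hy₀c).add ((hD.hasFDerivAt y₀).hasFDerivWithinAt.const_mul a))
  obtain ⟨r, hr, hra, hAβ, hχ⟩ := S.exists_normal_eq hΩ hD (H₁ S) hy₀
  have h1 := hκv (Nt (X y₀))
  have h2 := hD.concave y₀ (Nt (X y₀))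
  have h3 := hΩ.concave (X y₀) (N y₀)
  rw [hΩ.norm_grad _ (S.mapsTo_frontier y₀ hy₀)] at h2
  rw [hD.norm_grad _ hy₀] at h3
  simp only [_root_.add_apply, ContinuousLinearMap.comp_apply, fderivInnerCLM_apply,
    ContinuousLinearMap.prod_apply, hAβ, map_smul, inner_smul_right,
    _root_.smul_apply, innerSL_apply_apply, smul_eq_mul] at h1
  rw [real_inner_comm] at h3
  have h4 := mul_nonneg hκ hχ.le
  have h5 := mul_nonneg hr.le hΩ.pos.le
  rw [div_le_iff₀ (by positivity)]
  nlinarith [mul_le_mul_of_nonneg_left h3 hr.le]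

end DualSolution

end Obliqueness

section InteriorEstimate

set_option maxSynthPendingDepth 5

variable {E : Type*} [NormedAddCommGroup E] [InnerProductSpace ℝ E] {ι : Type*} [Fintype ι]

lemma ContinuousLinearMap.norm_apply_le_of_inner_le {B : E →L[ℝ] E} {M : ℝ}
    (hsymm : ∀ v w, ⟪B v, w⟫ = ⟪B w, v⟫) (hpos : ∀ v, 0 ≤ ⟪B v, v⟫)
    (hM : ∀ v, ‖v‖ ≤ 1 → ⟪B v, v⟫ ≤ M) {v : E} (hv : ‖v‖ ≤ 1) : ‖B v‖ ≤ M := by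
  by_cases h0 : B v = 0
  · rw [h0, norm_zero]; simpa using hM 0 (by simp)
  have hn : ‖B v‖ ≠ 0 := norm_ne_zero_iff.2 h0
  set w := ‖B v‖⁻¹ • B v with hw
  have hwn : ‖w‖ ≤ 1 := by rw [hw, norm_smul, norm_inv, norm_norm, inv_mul_cancel₀ hn]
  have h1 : ⟪B v, w⟫ = ‖B v‖ := by
    rw [hw, inner_smul_right, real_inner_self_eq_norm_sq]; field_simp
  have h2 := hpos (v - w)
  rw [map_sub, inner_sub_left, inner_sub_right, inner_sub_right, hsymm w v, h1] at h2
  have := hM v hv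
  have := hM w hwn
  linarith

namespace DualSolution

variable {Ω D : Set E} {ε l Cb Cr C₁ C₂ : ℝ} {h ht : E → ℝ} {N Nt : E → E} {θ θt CN : ℝ}
  {X : E → E} {A : E → E →L[ℝ] E} {T : E → E →L[ℝ] E →L[ℝ] E} {b : E → ι → E} {g : E → E}

/-- The functional `B ↦ ⟪e, B e⟫`. -/
def quadCLM (e : E) : (E →L[ℝ] E) →L[ℝ] ℝ :=
  (innerSL ℝ e).comp (ContinuousLinearMap.apply ℝ E e)

@[simp] lemma quadCLM_apply (e : E) (B : E →L[ℝ] E) : quadCLM e B = ⟪B e, e⟫ := by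
  simp [quadCLM, real_inner_comm]

lemma hasFDerivWithinAt_quad (S : DualSolution Ω D ε l Cb Cr C₁ C₂ X A T b g) (e : E) {y : E}
    (hy : y ∈ closure D) :
    HasFDerivWithinAt (fun z => ⟪A z e, e⟫) ((quadCLM e).comp (T y)) (closure D) y := by
  have := (quadCLM e).hasFDerivAt.comp_hasFDerivWithinAt y (S.hasFDeriv_A y hy)
  refine this.congr (fun z _ => ?_) ?_ <;> simp

lemma continuousOn_A (S : DualSolution Ω D ε l Cb Cr C₁ C₂ X A T b g) :
    ContinuousOn A (closure D) := fun y hy => (S.hasFDeriv_A y hy).continuousWithinAt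

lemma quad_nonneg (S : DualSolution Ω D ε l Cb Cr C₁ C₂ X A T b g) {y : E}
    (hy : y ∈ closure D) (v : E) : 0 ≤ ⟪A y v, v⟫ := by
  by_cases hv : v = 0
  · simp [hv]
  · exact (S.pos_A y hy v hv).le

/-- Comparison for the pure second derivatives, corrected by a smooth function of `(X y, y)`. -/
lemma quad_sub_comp_le [FiniteDimensional ℝ E] {P : Type*} [NormedAddCommGroup P]
    [NormedSpace ℝ P] {μ : ℝ} (hD : ConvexDomain D h N θ)
    (S : DualSolution Ω D ε l Cb Cr C₁ C₂ X A T b g) (hμ : 0 < μ)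
    (hbar : ∀ y ∈ D, ∑ k, ⟪fderiv ℝ N y (b y k), b y k⟫ + ⟪N y, g y⟫ ≤ -μ)
    {G : P × E × E → ℝ} (hG : ContDiff ℝ 2 G) {p : P} {e : E} {t C M m : ℝ} (he : ‖e‖ ≤ 1)
    (ht0 : 0 ≤ t) (hC : 0 ≤ C) (hM0 : 0 ≤ M) (hε : 0 ≤ ε) (hC₂ : 0 ≤ C₂)
    (hM : ∀ y ∈ D, ‖A y e‖ ≤ M)
    (hbound : ∀ y ∈ D, |∑ k, graphHess G p X A T y (b y k) (b y k) +
      (fderiv ℝ G (p, X y, y)).comp (graphDeriv P (A y)) (g y)| ≤ C)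
    (hm : ∀ y ∈ frontier D, ⟪A y e, e⟫ - t * G (p, X y, y) ≤ m) :
    ∀ y ∈ closure D, ⟪A y e, e⟫ - t * G (p, X y, y) ≤
      m + (C₂ + 2 * ε * M + t * C + 1) / μ * h y := by
  have ho := hD.isOpen
  refine hD.le_add_barrier hμ hbar (φ := fun y => ⟪A y e, e⟫ - t * G (p, X y, y))
    (φ' := fun y => (quadCLM e).comp (T y) -
      t • (fderiv ℝ G (p, X y, y)).comp (graphDeriv P (A y)))
    (φ'' := fun y => (ContinuousLinearMap.compL ℝ E (E →L[ℝ] E) ℝ (quadCLM e)).comp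
      (fderiv ℝ T y) - t • graphHess G p X A T y) (by positivity)
    (fun y hy => ((S.hasFDerivWithinAt_quad e hy).sub ((hasFDerivWithinAt_comp_graph hG
      (S.hasFDeriv_X y hy) p).const_mul t)).continuousWithinAt)
    (fun y hy => ?_) (fun y hy => ?_) (fun y hy => ?_) hm
  · exact ((S.hasFDerivWithinAt_quad e (subset_closure hy)).sub ((hasFDerivWithinAt_comp_graph hG
      (S.hasFDeriv_X y (subset_closure hy)) p).const_mul t)).hasFDerivAt
      (Filter.mem_of_superset (ho.mem_nhds hy) subset_closure)
  · exact ((ContinuousLinearMap.compL ℝ E (E →L[ℝ] E) ℝ (quadCLM e)).hasFDerivAt.comp y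
      (S.differentiableAt_T y hy).hasFDerivAt).sub ((hasFDerivAt_comp_graph_deriv hG
        (S.hasFDerivAt_X ho hy) (S.hasFDerivAt_A ho hy) p).const_smul t)
  · have h1 := S.hess y hy e he
    have h2 := (abs_le.1 (hbound y hy)).2
    have h3 := hM y hy
    simp only [_root_.sub_apply, ContinuousLinearMap.comp_apply, ContinuousLinearMap.compL_apply,
      quadCLM_apply, _root_.smul_apply, smul_eq_mul, Finset.sum_sub_distrib,
      ← Finset.mul_sum] at h2 ⊢
    nlinarith [mul_le_mul_of_nonneg_left h2 ht0, mul_le_mul_of_nonneg_left h3 hε]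

/-- The interior second derivatives are controlled by those on the boundary. -/
lemma quad_le_of_frontier [FiniteDimensional ℝ E] {m : ℝ} (hD : ConvexDomain D h N θ)
    (S : DualSolution Ω D ε l Cb Cr C₁ C₂ X A T b g) (hl : 0 < l) (hε : 0 ≤ ε) (hC₂ : 0 ≤ C₂)
    (hN : ∀ y ∈ closure D, ‖N y‖ ≤ CN) (hh : ∀ y ∈ closure D, h y ≤ CN)
    (hεN : 4 * ε * CN ≤ θ * l / 2)
    (hm : ∀ y ∈ frontier D, ∀ e, ‖e‖ ≤ 1 → ⟪A y e, e⟫ ≤ m) :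
    ∀ y ∈ closure D, ∀ e, ‖e‖ ≤ 1 →
      ⟪A y e, e⟫ ≤ 2 * m + 2 * ((C₂ + 1) / (θ * l / 2) * CN) := by
  have := FiniteDimensional.proper_real E
  have hμ : 0 < θ * l / 2 := by have := hD.pos; positivity
  have hbar := S.barrier hD hN (by linarith)
  set μ := θ * l / 2
  have hcont : ContinuousOn (fun z : E × E => ⟪A z.1 z.2, z.2⟫)
      (closure D ×ˢ Metric.closedBall 0 1) :=
    ((S.continuousOn_A.comp continuousOn_fst fun z hz => hz.1).clm_apply continuousOn_snd).inner
      continuousOn_snd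
  obtain ⟨⟨y₀, e₀⟩, ⟨hy₀, he₀⟩, hmax⟩ :=
    (hD.isCompact_closure.prod (isCompact_closedBall (0 : E) 1)).exists_isMaxOn
      (hD.nonempty.closure.prod ⟨0, by simp⟩) hcont
  have he₀' : ‖e₀‖ ≤ 1 := by simpa using he₀
  set M := ⟪A y₀ e₀, e₀⟫ with hMdef
  have hM : ∀ y ∈ closure D, ∀ e, ‖e‖ ≤ 1 → ⟪A y e, e⟫ ≤ M := fun y hy e he =>
    hmax (show (y, e) ∈ _ from ⟨hy, by simpa using he⟩)
  have hM0 : 0 ≤ M := S.quad_nonneg hy₀ e₀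
  have h1 := S.quad_sub_comp_le hD hμ hbar (G := fun _ : ℝ × E × E => 0) contDiff_const
    (p := 0) (t := 0) (C := |C₁ + ε + Fintype.card ι * (Cr + Cb) ^ 2|) (M := M) (m := m)
    he₀' le_rfl (abs_nonneg _) hM0 hε hC₂
    (fun y hy => ContinuousLinearMap.norm_apply_le_of_inner_le (S.symm_A y (subset_closure hy))
      (S.quad_nonneg (subset_closure hy)) (hM y (subset_closure hy)) he₀')
    (fun y hy => (S.abs_operator_comp_le (C := 0) le_rfl hy (by simp) (by simp)).trans
      (by simp))
    (fun y hy => by simpa using hm y hy e₀ he₀') y₀ hy₀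
  have h2 : M ≤ m + (C₂ + 2 * ε * M + 1) / μ * CN := by
    have h0 : h y₀ ≤ CN := hh y₀ hy₀
    have : (C₂ + 2 * ε * M + 1) / μ * h y₀ ≤ (C₂ + 2 * ε * M + 1) / μ * CN := by gcongr
    simp only [zero_mul, mul_zero, sub_zero, add_zero] at h1
    linarith
  have h3 : (C₂ + 2 * ε * M + 1) / μ * CN = (C₂ + 1) / μ * CN + 2 * ε * CN / μ * M := by
    field_simp; ring
  have h4 : 2 * ε * CN / μ ≤ 1 / 2 := by rw [div_le_iff₀ hμ]; linarith
  have h5 : M ≤ 2 * m + 2 * ((C₂ + 1) / μ * CN) := by nlinarith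
  exact fun y hy e he => (hM y hy e he).trans h5

/-- Splitting a direction into its tangential part and its part along the normal of `Ω`. -/
lemma quad_le_of_tangential (hΩ : ConvexDomain Ω ht Nt θt) (hD : ConvexDomain D h N θ)
    (S : DualSolution Ω D ε l Cb Cr C₁ C₂ X A T b g) {a M : ℝ}
    (ha : ∀ y ∈ closure D, ht (X y) ≤ a * h y) {y : E} (hy : y ∈ frontier D)
    (hM : ∀ v, ‖v‖ ≤ 1 → ⟪N y, v⟫ = 0 → ⟪A y v, v⟫ ≤ M) (e : E) :
    ⟪A y e, e⟫ ≤ M * ‖e - (⟪N y, e⟫ / ⟪N y, Nt (X y)⟫) • Nt (X y)‖ ^ 2 +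
      a * (⟪N y, e⟫ / ⟪N y, Nt (X y)⟫) ^ 2 := by
  obtain ⟨r, hr, hra, hAβ, hχ⟩ := S.exists_normal_eq hΩ hD ha hy
  have hyc := frontier_subset_closure hy
  have hβ : ‖Nt (X y)‖ = 1 := hΩ.norm_grad _ (S.mapsTo_frontier y hy)
  have hν : ‖N y‖ = 1 := hD.norm_grad _ hy
  have hχ1 : ⟪N y, Nt (X y)⟫ ≤ 1 := by
    simpa [hβ, hν] using real_inner_le_norm (N y) (Nt (X y))
  set χ := ⟪N y, Nt (X y)⟫
  set β := Nt (X y)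
  set s := ⟪N y, e⟫ / χ with hs
  set τ := e - s • β with hτ
  have hτν : ⟪N y, τ⟫ = 0 := by
    rw [hτ, inner_sub_right, inner_smul_right, hs]
    change _ - _ / χ * χ = 0
    field_simp; simp
  have hττ : ⟪A y τ, τ⟫ ≤ M * ‖τ‖ ^ 2 := by
    by_cases h0 : τ = 0
    · simp [h0]
    have hn : ‖τ‖ ≠ 0 := norm_ne_zero_iff.2 h0
    have := hM (‖τ‖⁻¹ • τ) (by rw [norm_smul, norm_inv, norm_norm, inv_mul_cancel₀ hn])
      (by rw [inner_smul_right, hτν, mul_zero])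
    rw [map_smul, inner_smul_left, inner_smul_right] at this
    simp only [RCLike.conj_to_real] at this
    field_simp at this
    linarith
  have hee : ⟪A y e, e⟫ = ⟪A y τ, τ⟫ + s ^ 2 * (r * χ) := by
    have e1 : e = τ + s • β := by rw [hτ]; abel
    have e2 : ⟪A y τ, β⟫ = 0 := by
      rw [S.symm_A y hyc, hAβ, inner_smul_left, hτν, mul_zero]
    have e3 : ⟪A y β, τ⟫ = 0 := by rw [S.symm_A y hyc, e2]
    have e4 : ⟪A y β, β⟫ = r * χ := by rw [hAβ, inner_smul_left]; rfl
    conv_lhs => rw [e1]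
    simp only [map_add, map_smul, inner_add_left, inner_add_right, inner_smul_left,
      inner_smul_right, e2, e3, e4, RCLike.conj_to_real]
    ring
  rw [hee]
  have : s ^ 2 * (r * χ) ≤ s ^ 2 * a :=
    mul_le_mul_of_nonneg_left (by nlinarith) (sq_nonneg _)
  linarith

/-- Differentiating `ht ∘ X ≥ 0` twice along a curve in `closure D` tangent to the boundary. -/
lemma second_order_frontier (hΩ : ConvexDomain Ω ht Nt θt) (hD : ConvexDomain D h N θ)
    (S : DualSolution Ω D ε l Cb Cr C₁ C₂ X A T b g) {y e : E} {r k : ℝ} (hy : y ∈ frontier D)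
    (hk : ‖fderiv ℝ N y‖ < 2 * k) (hr : A y (Nt (X y)) = r • N y) (he : ‖e‖ ≤ 1)
    (hNe : ⟪N y, e⟫ = 0) :
    0 ≤ ⟪fderiv ℝ Nt (X y) (A y e), A y e⟫ + ⟪T y (Nt (X y)) e, e⟫ + 2 * k * r := by
  have hyc := frontier_subset_closure hy
  have hν : ‖N y‖ = 1 := hD.norm_grad _ hy
  have hh0 : h y = 0 := hD.mem_frontier_iff.1 hy
  have hνν : ⟪N y, N y⟫ = 1 := by rw [real_inner_self_eq_norm_sq, hν]; norm_num
  set c : ℝ → E := fun t => y + t • e + (k * t ^ 2) • N y with hc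
  set c' : ℝ → E := fun t => e + (2 * k * t) • N y with hc'
  have hc0 : c 0 = y := by simp [hc]
  have hc'0 : c' 0 = e := by simp [hc']
  have hcd : ∀ t, HasDerivAt c (c' t) t := fun t => by
    have h1 : HasDerivAt (fun t : ℝ => k * t ^ 2) (2 * k * t) t := by
      have := (hasDerivAt_pow 2 t).const_mul k
      refine this.congr_deriv ?_
      simp; ring
    have h2 := (((hasDerivAt_id t).smul_const e).const_add y).add (h1.smul_const (N y))
    exact h2.congr_deriv (by simp [hc'])
  have hcd' : HasDerivAt c' ((2 * k) • N y) 0 := by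
    have h1 : HasDerivAt (fun t : ℝ => 2 * k * t) (2 * k) 0 := by
      simpa using (hasDerivAt_id (0 : ℝ)).const_mul (2 * k)
    exact (h1.smul_const (N y)).const_add e
  have hk1 : ∀ t, HasDerivAt (fun t => h (c t)) ⟪N (c t), c' t⟫ t := fun t =>
    (hD.hasFDerivAt _).comp_hasDerivAt t (hcd t)
  have hk2 : HasDerivAt (fun t => ⟪N (c t), c' t⟫)
      (⟪N y, (2 * k) • N y⟫ + ⟪fderiv ℝ N y e, e⟫) 0 := by
    have := ((hD.hasFDerivAt_grad (c 0)).comp_hasDerivAt (0 : ℝ) (hcd 0)).inner ℝ hcd'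
    simpa [hc0, hc'0] using this
  have hd1 : deriv (fun t => h (c t)) = fun t => ⟪N (c t), c' t⟫ :=
    funext fun t => (hk1 t).deriv
  have hlm : IsLocalMin (fun t => h (c t)) 0 := by
    refine isLocalMin_of_deriv_deriv_pos ?_ ?_ (hk1 0).continuousAt
    · rw [hd1, hk2.deriv, inner_smul_right, hνν]
      have h1 := neg_le_of_abs_le (abs_real_inner_le_norm (fderiv ℝ N y e) e)
      have h2 := (fderiv ℝ N y).le_opNorm e
      have h3 := norm_nonneg (fderiv ℝ N y)
      have h4 := norm_nonneg e
      have h5 : ‖fderiv ℝ N y e‖ * ‖e‖ ≤ ‖fderiv ℝ N y‖ := by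
        nlinarith [norm_nonneg (fderiv ℝ N y e), mul_le_mul_of_nonneg_left he h3]
      linarith
    · rw [hd1]; simp [hc0, hc'0, hNe]
  have hmem : ∀ᶠ t in 𝓝 (0 : ℝ), c t ∈ closure D := by
    filter_upwards [hlm] with t htt
    rw [hD.mem_closure_iff]
    simpa [hc0, hh0] using htt
  have hX : ∀ᶠ t in 𝓝 (0 : ℝ), HasDerivAt (fun t => X (c t)) (A (c t) (c' t)) t := by
    filter_upwards [hmem.eventually_nhds] with t htt
    exact (S.hasFDeriv_X (c t) htt.self_of_nhds).comp_hasDerivAt t (hcd t) htt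
  have hA : HasDerivAt (fun t => A (c t)) (T y e) 0 := by
    have := (S.hasFDeriv_A (c 0) (by rwa [hc0])).comp_hasDerivAt (0 : ℝ) (hcd 0) hmem
    exact this.congr_deriv (by rw [hc0, hc'0])
  have hg1 : ∀ᶠ t in 𝓝 (0 : ℝ), HasDerivAt (fun t => ht (X (c t)))
      ⟪Nt (X (c t)), A (c t) (c' t)⟫ t := by
    filter_upwards [hX] with t htt
    exact (hΩ.hasFDerivAt _).comp_hasDerivAt t htt
  have hg2 := ((hΩ.hasFDerivAt_grad (X (c 0))).comp_hasDerivAt (0 : ℝ) hX.self_of_nhds).inner ℝ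
    (hA.clm_apply hcd')
  have hgm : IsLocalMin (fun t => ht (X (c t))) 0 := by
    filter_upwards [hmem] with t htt
    rw [hc0, hΩ.mem_frontier_iff.1 (S.mapsTo_frontier y hy)]
    exact hΩ.mem_closure_iff.1 (S.mapsTo_closure hD.isOpen htt)
  have hfin := hgm.second_deriv_nonneg hg1 hg2
  have e1 : ⟪Nt (X y), T y e e⟫ = ⟪T y (Nt (X y)) e, e⟫ := by
    rw [real_inner_comm, S.symm_T_inner y hyc, S.symm_T y hyc]
  have e2 : ⟪Nt (X y), A y (N y)⟫ = r := by
    rw [real_inner_comm, S.symm_A y hyc, hr, inner_smul_left, hνν]; simp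
  simp only [hc0, hc'0, Function.comp_apply, map_smul, inner_add_right, inner_smul_right, e1,
    e2] at hfin
  linarith

end DualSolution

end InteriorEstimate

section BoundaryEstimate

set_option maxSynthPendingDepth 5

variable {E : Type*} [NormedAddCommGroup E] [InnerProductSpace ℝ E] {ι : Type*} [Fintype ι]

/-- The correction function on the boundary, with parameters `(s, e, ν₀, β₀)`. -/
def boundaryCorrection (N Nt : E → E) (C : ℝ) (z : (ℝ × E × E × E) × E × E) : ℝ :=
  -2 * z.1.1 * ⟪N z.2.2, z.1.2.1⟫ +
    C * (‖N z.2.2 - z.1.2.2.1‖ ^ 2 + ‖Nt z.2.1 - z.1.2.2.2‖ ^ 2)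

lemma contDiff_boundaryCorrection {N Nt : E → E} (hN : ContDiff ℝ 2 N) (hNt : ContDiff ℝ 2 Nt)
    (C : ℝ) : ContDiff ℝ 2 (boundaryCorrection N Nt C) := by
  have h1 : ContDiff ℝ 2 (fun z : (ℝ × E × E × E) × E × E => N z.2.2) :=
    hN.comp (contDiff_snd.comp contDiff_snd)
  have h2 : ContDiff ℝ 2 (fun z : (ℝ × E × E × E) × E × E => Nt z.2.1) :=
    hNt.comp (contDiff_fst.comp contDiff_snd)
  have h3 : ContDiff ℝ 2 (fun z : (ℝ × E × E × E) × E × E => z.1.1) := by fun_prop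
  have h4 : ContDiff ℝ 2 (fun z : (ℝ × E × E × E) × E × E => z.1.2.1) := by fun_prop
  have h5 : ContDiff ℝ 2 (fun z : (ℝ × E × E × E) × E × E => z.1.2.2.1) := by fun_prop
  have h6 : ContDiff ℝ 2 (fun z : (ℝ × E × E × E) × E × E => z.1.2.2.2) := by fun_prop
  exact ((contDiff_const.mul h3).mul (h1.inner ℝ h4)).add (contDiff_const.mul
    (((h1.sub h5).norm_sq ℝ).add ((h2.sub h6).norm_sq ℝ)))

/-- Tangential decompositions at two unit-vector pairs `(ν, β)`, `(ν₀, β₀)` with `⟪ν₀, e⟫ = 0`. -/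
lemma norm_sub_smul_sq_le {ν β ν₀ β₀ e : E} {c : ℝ} (hc : 0 < c) (hν : ‖ν‖ = 1) (hβ : ‖β‖ = 1)
    (hβ₀ : ‖β₀‖ = 1) (he : ‖e‖ ≤ 1) (he₀ : ⟪ν₀, e⟫ = 0)
    (hχ : c ≤ ⟪ν, β⟫) (hχ₀ : c ≤ ⟪ν₀, β₀⟫) {a M : ℝ} (ha : 0 ≤ a) (hM : 1 ≤ M) :
    M * ‖e - (⟪ν, e⟫ / ⟪ν, β⟫) • β‖ ^ 2 + a * (⟪ν, e⟫ / ⟪ν, β⟫) ^ 2 ≤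
      M + M * (-2 * (⟪β₀, e⟫ / ⟪ν₀, β₀⟫) * ⟪ν, e⟫ +
        (5 + a) / c ^ 2 * (‖ν - ν₀‖ ^ 2 + ‖β - β₀‖ ^ 2)) := by
  have hc1 : c ≤ 1 := hχ.trans (by simpa [hν, hβ] using real_inner_le_norm ν β)
  have hσ : |⟪ν, e⟫| ≤ ‖ν - ν₀‖ := by
    have h1 : ⟪ν, e⟫ = ⟪ν - ν₀, e⟫ := by rw [inner_sub_left, he₀, sub_zero]
    rw [h1]
    exact (abs_real_inner_le_norm _ _).trans (mul_le_of_le_one_right (norm_nonneg _) he)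
  have hδ : |⟪β, e⟫ - ⟪β₀, e⟫| ≤ ‖β - β₀‖ := by
    rw [← inner_sub_left]
    exact (abs_real_inner_le_norm _ _).trans (mul_le_of_le_one_right (norm_nonneg _) he)
  have hβ₀e : |⟪β₀, e⟫| ≤ 1 := by
    refine (abs_real_inner_le_norm _ _).trans ?_
    rw [hβ₀, one_mul]; exact he
  have hχχ : |⟪ν₀, β₀⟫ - ⟪ν, β⟫| ≤ ‖ν - ν₀‖ + ‖β - β₀‖ := by
    have h1 : ⟪ν₀, β₀⟫ - ⟪ν, β⟫ = -⟪ν - ν₀, β₀⟫ - ⟪ν, β - β₀⟫ := by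
      rw [inner_sub_left, inner_sub_right]; ring
    rw [h1]
    have h2 := abs_real_inner_le_norm (ν - ν₀) β₀
    have h3 := abs_real_inner_le_norm ν (β - β₀)
    rw [hβ₀, mul_one] at h2
    rw [hν, one_mul] at h3
    refine (abs_sub _ _).trans ?_
    rw [abs_neg]; linarith
  have hsq : ‖e - (⟪ν, e⟫ / ⟪ν, β⟫) • β‖ ^ 2 ≤
      1 - 2 * (⟪ν, e⟫ / ⟪ν, β⟫) * ⟪β, e⟫ + (⟪ν, e⟫ / ⟪ν, β⟫) ^ 2 := by
    rw [norm_sub_sq_real, inner_smul_right, norm_smul, hβ, mul_one, Real.norm_eq_abs, sq_abs,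
      real_inner_comm β e]
    have : ‖e‖ ^ 2 ≤ 1 := pow_le_one₀ (norm_nonneg _) he
    linarith
  set σ := ⟪ν, e⟫
  set χ := ⟪ν, β⟫
  set χ₀ := ⟪ν₀, β₀⟫
  set d := ‖ν - ν₀‖
  set d' := ‖β - β₀‖
  set ρ := ⟪β, e⟫
  set ρ₀ := ⟪β₀, e⟫
  have hd : 0 ≤ d := norm_nonneg _
  have hd' : 0 ≤ d' := norm_nonneg _
  have hχp : 0 < χ := hc.trans_le hχ
  have hχ₀p : 0 < χ₀ := hc.trans_le hχ₀
  have hs2 : (σ / χ) ^ 2 ≤ d ^ 2 / c ^ 2 := by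
    rw [div_pow, ← sq_abs σ]
    gcongr
  have hdiff : |ρ / χ - ρ₀ / χ₀| ≤ (d + 2 * d') / c ^ 2 := by
    have h1 : ρ / χ - ρ₀ / χ₀ = (ρ - ρ₀) / χ + ρ₀ * (χ₀ - χ) / (χ * χ₀) := by
      field_simp; ring
    have h2 : |(ρ - ρ₀) / χ| ≤ d' / c := by
      rw [abs_div, abs_of_pos hχp]; gcongr
    have h3 : |ρ₀ * (χ₀ - χ) / (χ * χ₀)| ≤ 1 * (d + d') / (c * c) := by
      rw [abs_div, abs_mul, abs_of_pos (mul_pos hχp hχ₀p)]; gcongr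
    have h4 : d' / c ≤ d' / c ^ 2 := by
      gcongr; nlinarith
    rw [h1]
    refine (abs_add_le _ _).trans ((add_le_add (h2.trans h4) h3).trans_eq ?_)
    field_simp; ring
  have hcross : -2 * (σ / χ) * ρ + 2 * (ρ₀ / χ₀) * σ ≤ 2 * (d * ((d + 2 * d') / c ^ 2)) := by
    have h1 : -2 * (σ / χ) * ρ + 2 * (ρ₀ / χ₀) * σ = -2 * (σ * (ρ / χ - ρ₀ / χ₀)) := by
      field_simp; ring
    have h2 : |σ * (ρ / χ - ρ₀ / χ₀)| ≤ d * ((d + 2 * d') / c ^ 2) := by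
      rw [abs_mul]; gcongr
    rw [h1]
    have := (abs_le.1 h2).1
    linarith
  have hfin : 2 * (d * ((d + 2 * d') / c ^ 2)) + (1 + a) * (d ^ 2 / c ^ 2) ≤
      (5 + a) / c ^ 2 * (d ^ 2 + d' ^ 2) := by
    have h1 : 2 * (d * ((d + 2 * d') / c ^ 2)) + (1 + a) * (d ^ 2 / c ^ 2) =
        (2 * d ^ 2 + 4 * d * d' + (1 + a) * d ^ 2) / c ^ 2 := by ring
    have h2 : (5 + a) / c ^ 2 * (d ^ 2 + d' ^ 2) = ((5 + a) * (d ^ 2 + d' ^ 2)) / c ^ 2 := by ring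
    rw [h1, h2]
    gcongr
    nlinarith [sq_nonneg (d - d'), mul_nonneg ha (sq_nonneg d')]
  have hs0 := sq_nonneg (σ / χ)
  have h7 : M * ‖e - (σ / χ) • β‖ ^ 2 ≤
      M * (1 - 2 * (σ / χ) * ρ + (σ / χ) ^ 2) := by gcongr
  have h8 : a * (σ / χ) ^ 2 ≤ M * (a * (d ^ 2 / c ^ 2)) := by
    have : 0 ≤ a * (d ^ 2 / c ^ 2) := by positivity
    have h9 : a * (σ / χ) ^ 2 ≤ a * (d ^ 2 / c ^ 2) := by gcongr
    nlinarith
  have h10 : 1 - 2 * (σ / χ) * ρ + (σ / χ) ^ 2 + a * (d ^ 2 / c ^ 2) ≤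
      1 + (-2 * (ρ₀ / χ₀) * σ + (5 + a) / c ^ 2 * (d ^ 2 + d' ^ 2)) := by linarith
  have h11 := mul_le_mul_of_nonneg_left h10 (zero_le_one.trans hM)
  linarith

namespace DualSolution

variable {Ω D : Set E} {l Cb Cr C₁ C₂ : ℝ} {h ht : E → ℝ} {N Nt : E → E} {θ θt : ℝ}

set_option maxHeartbeats 1000000 in
/-- The global second derivative estimate for dual solutions. -/
theorem exists_bound [FiniteDimensional ℝ E] [Nontrivial E]
    (hΩ : ConvexDomain Ω ht Nt θt) (hD : ConvexDomain D h N θ) (hl : 0 < l) (hC₂ : 0 ≤ C₂) :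
    ∃ ε C : ℝ, 0 < ε ∧ ε ≤ 1 ∧ 0 < C ∧ ∀ ⦃X : E → E⦄ ⦃A : E → E →L[ℝ] E⦄
      ⦃T : E → E →L[ℝ] E →L[ℝ] E⦄ ⦃b : E → ι → E⦄ ⦃g : E → E⦄,
      DualSolution Ω D ε l Cb Cr C₁ C₂ X A T b g →
      ∀ y ∈ closure D, ∀ e, ‖e‖ ≤ 1 → ⟪A y e, e⟫ ≤ C := by
  have := FiniteDimensional.proper_real E
  have hμ : 0 < θ * l / 2 := by have := hD.pos; positivity
  obtain ⟨c₁, hc₁⟩ := hD.isCompact_closure.exists_bound_of_continuousOn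
    hD.contDiff_grad.continuous.continuousOn
  obtain ⟨c₂, hc₂⟩ := hD.isCompact_closure.exists_bound_of_continuousOn
    (hD.contDiff_grad.continuous_fderiv (by norm_num)).continuousOn
  obtain ⟨c₃, hc₃⟩ := hD.isCompact_closure.exists_bound_of_continuousOn hD.continuous.continuousOn
  obtain ⟨CN, hCN, hN, hDN, hh⟩ : ∃ CN : ℝ, 1 ≤ CN ∧ (∀ y ∈ closure D, ‖N y‖ ≤ CN) ∧
      (∀ y ∈ closure D, ‖fderiv ℝ N y‖ ≤ CN) ∧ ∀ y ∈ closure D, h y ≤ CN := by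
    refine ⟨max 1 (max c₁ (max c₂ c₃)), le_max_left _ _, fun y hy => ?_, fun y hy => ?_,
      fun y hy => ?_⟩
    · exact (hc₁ y hy).trans (by simp)
    · exact (hc₂ y hy).trans (by simp)
    · exact (le_abs_self _).trans ((hc₃ y hy).trans (by simp))
  have hCN0 : 0 < CN := by linarith
  set ε := min 1 (θ * l / 2 / (4 * CN)) with hεdef
  have hε : 0 < ε := by positivity
  have hε4 : 4 * ε * CN ≤ θ * l / 2 := by
    have : ε ≤ θ * l / 2 / (4 * CN) := min_le_right _ _
    rw [le_div_iff₀ (by positivity)] at this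
    linarith
  have hε1 : ε * CN ≤ θ * l / 2 := by nlinarith [mul_pos hε hCN0]
  obtain ⟨a, ha, Ha⟩ := exists_le_mul_barrier (ι := ι) (Cb := Cb) (Cr := Cr) (C₁ := C₁)
    (C₂ := C₂) hΩ hD hl hN hε1
  obtain ⟨c, hc, Hc⟩ := exists_oblique (ι := ι) (Cb := Cb) (Cr := Cr) (C₁ := C₁)
    (C₂ := C₂) hΩ hD hl hN hε1
  set G := boundaryCorrection N Nt ((5 + a) / c ^ 2) with hGdef
  have hG : ContDiff ℝ 2 G := contDiff_boundaryCorrection hD.contDiff_grad hΩ.contDiff_grad _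
  obtain ⟨CG, hCG, HG⟩ := exists_fderiv_bound hΩ.isCompact_closure hD.isCompact_closure hG
    ((isCompact_closedBall (0 : ℝ) (1 / c)).prod ((isCompact_closedBall (0 : E) 1).prod
      ((isCompact_closedBall (0 : E) 1).prod (isCompact_closedBall (0 : E) 1))))
  set μ := θ * l / 2 with hμdef
  set CL := |CG * (C₁ + ε + Fintype.card ι * (Cr + Cb) ^ 2)| with hCL
  -- the crude bound of all second derivatives by the tangential ones on the boundary
  set B := 2 * ((1 + 1 / c) ^ 2 + a * (1 / c) ^ 2) + 2 * ((C₂ + 1) / μ * CN) with hB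
  have hB0 : 0 ≤ B := by positivity
  set Q := (C₂ + 2 * ε * (2 * B) + CL + 1) / μ + CG * (a + 1) + 2 * CN * a with hQ
  have hQ0 : 0 ≤ Q := by positivity
  have hθt := hΩ.pos
  refine ⟨ε, B * (max 1 (Q / θt) + 1) + 1, hε, min_le_left _ _, by positivity, ?_⟩
  intro X A T b g S
  have hcompact : IsCompact ({z : E × E | ⟪N z.1, z.2⟫ = 0} ∩
      (frontier D ×ˢ Metric.closedBall (0 : E) 1)) := by
    refine (hD.isCompact_frontier.prod (isCompact_closedBall (0 : E) 1)).inter_left ?_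
    exact isClosed_eq ((hD.contDiff_grad.continuous.comp continuous_fst).inner continuous_snd)
      continuous_const
  have hcont : ContinuousOn (fun z : E × E => ⟪A z.1 z.2, z.2⟫) ({z : E × E | ⟪N z.1, z.2⟫ = 0} ∩
      (frontier D ×ˢ Metric.closedBall (0 : E) 1)) :=
    ((S.continuousOn_A.comp continuousOn_fst fun z hz =>
      frontier_subset_closure hz.2.1).clm_apply continuousOn_snd).inner continuousOn_snd
  obtain ⟨yf, hyf⟩ := hD.nonempty_frontier
  obtain ⟨⟨y₀, e⟩, ⟨he₀, hy₀, he⟩, hmax⟩ := hcompact.exists_isMaxOn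
    ⟨(yf, 0), by simp, hyf, by simp⟩ hcont
  replace he : ‖e‖ ≤ 1 := by simpa using he
  replace he₀ : ⟪N y₀, e⟫ = 0 := he₀
  replace hy₀ : y₀ ∈ frontier D := hy₀
  have hy₀c := frontier_subset_closure hy₀
  set M := ⟪A y₀ e, e⟫ with hMdef
  have hM0 : 0 ≤ M := S.quad_nonneg hy₀c e
  have hM : ∀ y ∈ frontier D, ∀ v, ‖v‖ ≤ 1 → ⟪N y, v⟫ = 0 → ⟪A y v, v⟫ ≤ M :=
    fun y hy v hv hv0 => hmax (show (y, v) ∈ _ from ⟨hv0, hy, by simpa using hv⟩)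
  have hβ : ∀ y ∈ frontier D, ‖Nt (X y)‖ = 1 := fun y hy =>
    hΩ.norm_grad _ (S.mapsTo_frontier y hy)
  have hsplit : ∀ y ∈ frontier D, ∀ v, _ := fun y hy v =>
    S.quad_le_of_tangential hΩ hD (Ha S) hy (hM y hy) v
  have hcrude : ∀ y ∈ frontier D, ∀ v, ‖v‖ ≤ 1 →
      ⟪A y v, v⟫ ≤ ((1 + 1 / c) ^ 2 + a * (1 / c) ^ 2) * (M + 1) := by
    intro y hy v hv
    have hs : |⟪N y, v⟫ / ⟪N y, Nt (X y)⟫| ≤ 1 / c := by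
      have h1 := Hc S y hy
      rw [abs_div, abs_of_pos (hc.trans_le h1)]
      have h2 := abs_real_inner_le_norm (N y) v
      rw [hD.norm_grad y hy, one_mul] at h2
      gcongr
      exact h2.trans hv
    refine (hsplit y hy v).trans ?_
    set s := ⟪N y, v⟫ / ⟪N y, Nt (X y)⟫
    have h3 : ‖v - s • Nt (X y)‖ ≤ 1 + 1 / c := by
      refine (norm_sub_le _ _).trans ?_
      rw [norm_smul, hβ y hy, mul_one]
      exact add_le_add hv hs
    have h4 : M * ‖v - s • Nt (X y)‖ ^ 2 ≤ M * (1 + 1 / c) ^ 2 := by gcongr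
    have h5 : a * s ^ 2 ≤ a * (1 / c) ^ 2 := by
      rw [← sq_abs s]; gcongr
    have h6 : 0 ≤ a * (1 / c) ^ 2 * M := by positivity
    have h7 : 0 ≤ (1 + 1 / c) ^ 2 := by positivity
    linarith
  have hglobal : ∀ y ∈ closure D, ∀ v, ‖v‖ ≤ 1 → ⟪A y v, v⟫ ≤ B * (M + 1) := by
    intro y hy v hv
    refine (S.quad_le_of_frontier hD hl hε.le hC₂ hN hh hε4 hcrude y hy v hv).trans ?_
    have : 0 ≤ (C₂ + 1) / μ * CN * M := by positivity
    rw [← hμdef, hB]; linarith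
  suffices hMb : M ≤ max 1 (Q / θt) by
    intro y hy v hv
    have h1 := hglobal y hy v hv
    have h2 := mul_le_mul_of_nonneg_left hMb hB0
    linarith
  by_cases hM1 : M < 1
  · exact hM1.le.trans (le_max_left _ _)
  push Not at hM1
  obtain ⟨r, hr, hra, hAβ, hχ⟩ := S.exists_normal_eq hΩ hD (Ha S) hy₀
  set β := Nt (X y₀) with hβdef
  set χ := ⟪N y₀, β⟫ with hχdef
  have hν₀ : ‖N y₀‖ = 1 := hD.norm_grad _ hy₀
  have hβ₀ : ‖β‖ = 1 := hβ y₀ hy₀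
  set p : ℝ × E × E × E := (⟪β, e⟫ / χ, e, N y₀, β) with hp
  have hpK : p ∈ (Metric.closedBall (0 : ℝ) (1 / c)) ×ˢ ((Metric.closedBall (0 : E) 1) ×ˢ
      ((Metric.closedBall (0 : E) 1) ×ˢ (Metric.closedBall (0 : E) 1))) := by
    refine ⟨?_, ?_, ?_, ?_⟩
    · rw [mem_closedBall_zero_iff, Real.norm_eq_abs, hp]
      have h1 : c ≤ χ := Hc S y₀ hy₀
      have h2 := abs_real_inner_le_norm β e
      rw [hβ₀, one_mul] at h2
      simp only
      rw [abs_div, abs_of_pos hχ]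
      gcongr
      exact h2.trans he
    · simpa [hp] using he
    · simp [hp, hν₀]
    · simp [hp, hβ₀]
  have hbdry : ∀ y ∈ frontier D, ⟪A y e, e⟫ - M * G (p, X y, y) ≤ M := by
    intro y hy
    have h1 := hsplit y hy e
    have h2 := norm_sub_smul_sq_le hc (hD.norm_grad y hy) (hβ y hy) hβ₀ he he₀ (Hc S y hy)
      (Hc S y₀ hy₀) ha hM1
    have h3 : G (p, X y, y) = -2 * (⟪β, e⟫ / χ) * ⟪N y, e⟫ +
        (5 + a) / c ^ 2 * (‖N y - N y₀‖ ^ 2 + ‖Nt (X y) - β‖ ^ 2) := rfl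
    rw [h3]
    linarith
  have hAe : ∀ y ∈ D, ‖A y e‖ ≤ 2 * B * M := fun y hy => by
    have h1 := ContinuousLinearMap.norm_apply_le_of_inner_le (S.symm_A y (subset_closure hy))
      (S.quad_nonneg (subset_closure hy)) (hglobal y (subset_closure hy)) he
    nlinarith
  have hin := S.quad_sub_comp_le hD hμ (S.barrier hD hN hε1) hG (p := p) (e := e) (t := M)
    (C := CL) (M := 2 * B * M) (m := M) he hM0 (abs_nonneg _) (by positivity) hε.le hC₂ hAe
    (fun y hy => by
      have h1 := HG p hpK (X y) (subset_closure (S.mapsTo y hy)) y (subset_closure hy)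
      exact (S.abs_operator_comp_le hCG hy h1.1 h1.2).trans (le_abs_self _)) hbdry
  set A₃ := (C₂ + 2 * ε * (2 * B * M) + M * CL + 1) / μ with hA₃
  have hA₃0 : 0 ≤ A₃ := by positivity
  have hA₃M : A₃ ≤ (C₂ + 2 * ε * (2 * B) + CL + 1) / μ * M := by
    rw [hA₃, div_mul_eq_mul_div]
    gcongr
    nlinarith
  have hG0 : G (p, X y₀, y₀) = 0 := by
    change -2 * (⟪β, e⟫ / χ) * ⟪N y₀, e⟫ +
        (5 + a) / c ^ 2 * (‖N y₀ - N y₀‖ ^ 2 + ‖β - β‖ ^ 2) = 0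
    rw [he₀]; simp
  have hh0 : h y₀ = 0 := hD.mem_frontier_iff.1 hy₀
  obtain ⟨κ, hκ, hκv⟩ := hD.exists_eq_smul_of_isMinOn hy₀
    (ψ := fun z => A₃ * h z - (⟪A z e, e⟫ - M * G (p, X z, z)))
    (fun z hz => by
      have h1 := hin z hz
      simp only [mem_ofPred_eq, hh0, hG0, mul_zero, sub_zero, zero_sub, ← hMdef]
      linarith)
    (((hD.hasFDerivAt y₀).hasFDerivWithinAt.const_mul A₃).sub
      ((S.hasFDerivWithinAt_quad e hy₀c).sub ((hasFDerivWithinAt_comp_graph hG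
        (S.hasFDeriv_X y₀ hy₀c) p).const_mul M)))
  have hκβ := hκv β
  simp only [_root_.sub_apply, _root_.smul_apply, ContinuousLinearMap.comp_apply, quadCLM_apply,
    innerSL_apply_apply, smul_eq_mul] at hκβ
  have hχ1 : χ ≤ 1 := by simpa [hβ₀, hν₀] using real_inner_le_norm (N y₀) β
  have hGβ : fderiv ℝ G (p, X y₀, y₀) (graphDeriv (ℝ × E × E × E) (A y₀) β) ≤ CG * (a + 1) := by
    have h1 := (HG p hpK (X y₀) (frontier_subset_closure (S.mapsTo_frontier y₀ hy₀)) y₀ hy₀c).1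
    refine (le_abs_self _).trans (((fderiv ℝ G (p, X y₀, y₀)).le_opNorm _).trans ?_)
    refine mul_le_mul h1 ((norm_graphDeriv_apply_le _ _).trans ?_) (norm_nonneg _) hCG
    rw [hAβ, norm_smul, hν₀, hβ₀, Real.norm_of_nonneg hr.le]
    linarith
  have hT : ⟪T y₀ β e, e⟫ ≤ A₃ + M * (CG * (a + 1)) := by
    have h1 := mul_nonneg hκ hχ.le
    have h2 : A₃ * χ ≤ A₃ := mul_le_of_le_one_right hA₃0 hχ1
    have h3 := mul_le_mul_of_nonneg_left hGβ hM0
    linarith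
  have hso := S.second_order_frontier hΩ hD (k := CN) hy₀
    ((hDN y₀ hy₀c).trans_lt (by linarith)) hAβ he he₀
  have hconc := hΩ.concave (X y₀) (A y₀ e)
  have hMA : M ≤ ‖A y₀ e‖ :=
    (real_inner_le_norm _ _).trans (mul_le_of_le_one_right (norm_nonneg _) he)
  have hsqM : M ^ 2 ≤ ‖A y₀ e‖ ^ 2 := by gcongr
  have hfin : θt * M ^ 2 ≤ Q * M := by
    have h1 := mul_le_mul_of_nonneg_left hsqM hθt.le
    have h2 : 2 * CN * r ≤ 2 * CN * a := by gcongr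
    have h3 : 2 * CN * a ≤ 2 * CN * a * M := le_mul_of_one_le_right (by positivity) hM1
    rw [hQ]
    linarith
  refine le_trans ?_ (le_max_right _ _)
  rw [le_div_iff₀ hθt]
  nlinarith

end DualSolution

end BoundaryEstimate

section LinearizedEquation

set_option maxSynthPendingDepth 5

variable {E : Type*} [NormedAddCommGroup E] [InnerProductSpace ℝ E] {ι : Type*} [Fintype ι]

lemma ContDiffAt.eventually_hasFDerivAt {V W : Type*} [NormedAddCommGroup V] [NormedSpace ℝ V]
    [NormedAddCommGroup W] [NormedSpace ℝ W] {F : V → W} {z : V} (hF : ContDiffAt ℝ 2 F z) :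
    ∀ᶠ w in 𝓝 z, HasFDerivAt F (fderiv ℝ F w) w := by
  filter_upwards [hF.eventually (by simp)] with w hw
  exact (hw.differentiableAt (by norm_num)).hasFDerivAt

lemma ContDiffAt.hasFDerivAt_fderiv {V W : Type*} [NormedAddCommGroup V] [NormedSpace ℝ V]
    [NormedAddCommGroup W] [NormedSpace ℝ W] {F : V → W} {z : V} (hF : ContDiffAt ℝ 2 F z) :
    HasFDerivAt (fderiv ℝ F) (fderiv ℝ (fderiv ℝ F) z) z :=
  ((hF.fderiv_right (m := 1) (by norm_num)).differentiableAt (by norm_num)).hasFDerivAt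

/-- First and second order conditions at a minimum of
`F (X, ·) - 2 ∑ ⟪rₖ, bₖ⟫ + ∑ ⟪A bₖ, bₖ⟫`. -/
lemma linearized_of_isLocalMin {F : E × E → ℝ} {X : E → E} {A : E → E →L[ℝ] E}
    {T : E → E →L[ℝ] E →L[ℝ] E} {r : ι → E → E} {b : ι → E} {y : E}
    (hF : ContDiffAt ℝ 2 F (X y, y)) (hX : ∀ᶠ z in 𝓝 y, HasFDerivAt X (A z) z)
    (hA : ∀ᶠ z in 𝓝 y, HasFDerivAt A (T z) z) (hT : DifferentiableAt ℝ T y)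
    (hr : ∀ k, ContDiffAt ℝ 2 (r k) y)
    (hmin : IsLocalMin (fun z => F (X z, z) - 2 * ∑ k, ⟪r k z, b k⟫ + ∑ k, ⟪A z (b k), b k⟫) y)
    (ξ : E) :
    fderiv ℝ F (X y, y) (A y ξ, ξ) - 2 * ∑ k, ⟪fderiv ℝ (r k) y ξ, b k⟫ +
      ∑ k, ⟪T y ξ (b k), b k⟫ = 0 ∧
    0 ≤ fderiv ℝ (fderiv ℝ F) (X y, y) (A y ξ, ξ) (A y ξ, ξ) +
      fderiv ℝ F (X y, y) (T y ξ ξ, 0) - 2 * ∑ k, ⟪fderiv ℝ (fderiv ℝ (r k)) y ξ ξ, b k⟫ +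
      ∑ k, ⟪fderiv ℝ T y ξ ξ (b k), b k⟫ := by
  set c : ℝ → E := fun t => y + t • ξ with hc
  have hc0 : c 0 = y := by simp [hc]
  have hcd : ∀ t : ℝ, HasDerivAt c ξ t := fun t => by
    exact (((hasDerivAt_id t).smul_const ξ).const_add y).congr_deriv (by simp)
  have hlim : Filter.Tendsto c (𝓝 0) (𝓝 y) := by
    simpa [hc0] using (hcd 0).continuousAt.tendsto
  have hXy : HasFDerivAt X (A y) y := hX.self_of_nhds
  have hAy : HasFDerivAt A (T y) y := hA.self_of_nhds
  have hpair : Filter.Tendsto (fun z => (X z, z)) (𝓝 y) (𝓝 (X y, y)) :=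
    hXy.continuousAt.tendsto.prodMk_nhds Filter.tendsto_id
  have hF1 := hlim.eventually (hpair.eventually hF.eventually_hasFDerivAt)
  have hr1 : ∀ᶠ t in 𝓝 (0 : ℝ), ∀ k, HasFDerivAt (r k) (fderiv ℝ (r k) (c t)) (c t) :=
    Filter.eventually_all.2 fun k => hlim.eventually (hr k).eventually_hasFDerivAt
  have h1 : ∀ᶠ t in 𝓝 (0 : ℝ), HasDerivAt
      (fun t => F (X (c t), c t) - 2 * ∑ k, ⟪r k (c t), b k⟫ + ∑ k, ⟪A (c t) (b k), b k⟫)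
      (fderiv ℝ F (X (c t), c t) (A (c t) ξ, ξ) - 2 * ∑ k, ⟪fderiv ℝ (r k) (c t) ξ, b k⟫ +
        ∑ k, ⟪T (c t) ξ (b k), b k⟫) t := by
    filter_upwards [hF1, hr1, hlim.eventually hX, hlim.eventually hA] with t hFt hrt hXt hAt
    have e1 : HasDerivAt (fun t => F (X (c t), c t)) (fderiv ℝ F (X (c t), c t) (A (c t) ξ, ξ)) t :=
      hFt.comp_hasDerivAt t ((hXt.comp_hasDerivAt t (hcd t)).prodMk (hcd t))
    have e2 : ∀ k, HasDerivAt (fun t => ⟪r k (c t), b k⟫) ⟪fderiv ℝ (r k) (c t) ξ, b k⟫ t :=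
      fun k => by
        have := ((hrt k).comp_hasDerivAt t (hcd t)).inner ℝ (hasDerivAt_const t (b k))
        exact this.congr_deriv (by simp)
    have e3 : ∀ k, HasDerivAt (fun t => ⟪A (c t) (b k), b k⟫) ⟪T (c t) ξ (b k), b k⟫ t :=
      fun k => by
        have := ((hAt.comp_hasDerivAt t (hcd t)).clm_apply (hasDerivAt_const t (b k))).inner ℝ
          (hasDerivAt_const t (b k))
        exact this.congr_deriv (by simp)
    exact (e1.sub ((HasDerivAt.fun_sum fun k _ => e2 k).const_mul 2)).add
      (HasDerivAt.fun_sum fun k _ => e3 k)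
  have h2 : HasDerivAt
      (fun t => fderiv ℝ F (X (c t), c t) (A (c t) ξ, ξ) -
        2 * ∑ k, ⟪fderiv ℝ (r k) (c t) ξ, b k⟫ + ∑ k, ⟪T (c t) ξ (b k), b k⟫)
      (fderiv ℝ (fderiv ℝ F) (X y, y) (A y ξ, ξ) (A y ξ, ξ) +
        fderiv ℝ F (X y, y) (T y ξ ξ, 0) - 2 * ∑ k, ⟪fderiv ℝ (fderiv ℝ (r k)) y ξ ξ, b k⟫ +
        ∑ k, ⟪fderiv ℝ T y ξ ξ (b k), b k⟫) 0 := by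
    rw [← hc0] at hF hXy hAy hT
    have hXc : HasDerivAt (fun t => X (c t)) (A (c 0) ξ) 0 := hXy.comp_hasDerivAt (0 : ℝ) (hcd 0)
    have hAc : HasDerivAt (fun t => A (c t)) (T (c 0) ξ) 0 := hAy.comp_hasDerivAt (0 : ℝ) (hcd 0)
    have hTc : HasDerivAt (fun t => T (c t)) (fderiv ℝ T (c 0) ξ) 0 :=
      hT.hasFDerivAt.comp_hasDerivAt (0 : ℝ) (hcd 0)
    have hFc : HasDerivAt (fun t => fderiv ℝ F (X (c t), c t))
        (fderiv ℝ (fderiv ℝ F) (X (c 0), c 0) (A (c 0) ξ, ξ)) 0 :=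
      hF.hasFDerivAt_fderiv.comp_hasDerivAt (0 : ℝ) (hXc.prodMk (hcd 0))
    have hAξ : HasDerivAt (fun t => (A (c t) ξ, ξ)) (T (c 0) ξ ξ, (0 : E)) 0 :=
      ((hAc.clm_apply (hasDerivAt_const (0 : ℝ) ξ)).congr_deriv (by simp)).prodMk
        (hasDerivAt_const (0 : ℝ) ξ)
    have e1 : HasDerivAt (fun t => fderiv ℝ F (X (c t), c t) (A (c t) ξ, ξ))
        (fderiv ℝ (fderiv ℝ F) (X y, y) (A y ξ, ξ) (A y ξ, ξ) +
          fderiv ℝ F (X y, y) (T y ξ ξ, 0)) 0 :=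
      (hFc.clm_apply hAξ).congr_deriv (by rw [hc0])
    have e2 : ∀ k, HasDerivAt (fun t => ⟪fderiv ℝ (r k) (c t) ξ, b k⟫)
        ⟪fderiv ℝ (fderiv ℝ (r k)) y ξ ξ, b k⟫ 0 := fun k => by
      have hrk := hr k
      rw [← hc0] at hrk
      have := ((hrk.hasFDerivAt_fderiv.comp_hasDerivAt (0 : ℝ) (hcd 0)).clm_apply
        (hasDerivAt_const (0 : ℝ) ξ)).inner ℝ (hasDerivAt_const (0 : ℝ) (b k))
      exact this.congr_deriv (by simp [hc0])
    have e3 : ∀ k, HasDerivAt (fun t => ⟪T (c t) ξ (b k), b k⟫)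
        ⟪fderiv ℝ T y ξ ξ (b k), b k⟫ 0 := fun k => by
      have := ((hTc.clm_apply (hasDerivAt_const (0 : ℝ) ξ)).clm_apply
        (hasDerivAt_const (0 : ℝ) (b k))).inner ℝ (hasDerivAt_const (0 : ℝ) (b k))
      exact this.congr_deriv (by simp [hc0])
    exact (e1.sub ((HasDerivAt.fun_sum fun k _ => e2 k).const_mul 2)).add
      (HasDerivAt.fun_sum fun k _ => e3 k)
  have hm : IsLocalMin (fun t => F (X (c t), c t) - 2 * ∑ k, ⟪r k (c t), b k⟫ +
      ∑ k, ⟪A (c t) (b k), b k⟫) 0 := by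
    have := hlim.eventually hmin
    simpa [IsLocalMin, IsMinFilter, hc0] using this
  refine ⟨?_, hm.second_deriv_nonneg h1 h2⟩
  have := hm.hasDerivAt_eq_zero h1.self_of_nhds
  simpa only [hc0] using this

/-- The second derivative of a function concave along a direction. -/
lemma second_fderiv_nonpos_of_concave {V : Type*} [NormedAddCommGroup V] [NormedSpace ℝ V]
    {F : V → ℝ} {z v : V} (hF : ContDiffAt ℝ 2 F z)
    (hconc : ∀ᶠ t in 𝓝 (0 : ℝ), F (z + t • v) + F (z - t • v) ≤ 2 * F z) :
    fderiv ℝ (fderiv ℝ F) z v v ≤ 0 := by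
  have hcd : ∀ (σ t : ℝ), HasDerivAt (fun t : ℝ => z + (σ * t) • v) (σ • v) t := fun σ t => by
    have h1 : HasDerivAt (fun t : ℝ => σ * t) σ t := by
      simpa using (hasDerivAt_id t).const_mul σ
    exact (h1.smul_const v).const_add z
  have hlim : ∀ σ : ℝ, Filter.Tendsto (fun t : ℝ => z + (σ * t) • v) (𝓝 0) (𝓝 z) := fun σ => by
    simpa using (hcd σ 0).continuousAt.tendsto
  have h1 : ∀ᶠ t in 𝓝 (0 : ℝ), HasDerivAt
      (fun t => -(F (z + ((1 : ℝ) * t) • v) + F (z + ((-1 : ℝ) * t) • v)))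
      (-(fderiv ℝ F (z + ((1 : ℝ) * t) • v) ((1 : ℝ) • v) +
        fderiv ℝ F (z + ((-1 : ℝ) * t) • v) ((-1 : ℝ) • v))) t := by
    filter_upwards [(hlim 1).eventually hF.eventually_hasFDerivAt,
      (hlim (-1)).eventually hF.eventually_hasFDerivAt] with t h1 h2
    exact ((h1.comp_hasDerivAt t (hcd 1 t)).add (h2.comp_hasDerivAt t (hcd (-1) t))).neg
  have h2 : HasDerivAt (fun t : ℝ => -(fderiv ℝ F (z + ((1 : ℝ) * t) • v) ((1 : ℝ) • v) +
        fderiv ℝ F (z + ((-1 : ℝ) * t) • v) ((-1 : ℝ) • v)))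
        (-(2 * fderiv ℝ (fderiv ℝ F) z v v)) 0 := by
    have hz : ∀ σ : ℝ, HasFDerivAt (fderiv ℝ F) (fderiv ℝ (fderiv ℝ F) z)
        (z + (σ * (0 : ℝ)) • v) := fun σ => by simpa using hF.hasFDerivAt_fderiv
    have e : ∀ σ : ℝ, HasDerivAt (fun t : ℝ => fderiv ℝ F (z + (σ * t) • v) (σ • v))
        (fderiv ℝ (fderiv ℝ F) z (σ • v) (σ • v)) 0 := fun σ => by
      have h0 : HasDerivAt (fun t : ℝ => fderiv ℝ F (z + (σ * t) • v))
          (fderiv ℝ (fderiv ℝ F) z (σ • v)) 0 := (hz σ).comp_hasDerivAt (0 : ℝ) (hcd σ 0)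
      exact (h0.clm_apply (hasDerivAt_const (0 : ℝ) (σ • v))).congr_deriv (by simp)
    exact ((e 1).add (e (-1))).neg.congr_deriv (by simp; ring)
  have hm : IsLocalMin (fun t : ℝ => -(F (z + ((1 : ℝ) * t) • v) + F (z + ((-1 : ℝ) * t) • v))) 0 := by
    filter_upwards [hconc] with t ht
    simp only [mul_zero, zero_smul, add_zero, one_mul, neg_mul, neg_smul, ← sub_eq_add_neg]
    linarith
  have := hm.second_deriv_nonneg h1 h2
  linarith

end LinearizedEquation

section DualEquation

set_option maxSynthPendingDepth 5

variable {E : Type*} [NormedAddCommGroup E] [InnerProductSpace ℝ E] {ι : Type*} [Fintype ι]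

/-- Total symmetry of the fourth derivative of the dual potential. -/
lemma inner_fderiv_third_comm {A : E → E →L[ℝ] E} {T : E → E →L[ℝ] E →L[ℝ] E} {y : E}
    (hA : ∀ᶠ z in 𝓝 y, HasFDerivAt A (T z) z) (hT : DifferentiableAt ℝ T y)
    (hs : ∀ᶠ z in 𝓝 y, ∀ v w, T z v w = T z w v)
    (hsi : ∀ᶠ z in 𝓝 y, ∀ u v w, ⟪T z u v, w⟫ = ⟪T z u w, v⟫) (ξ b : E) :
    ⟪fderiv ℝ T y ξ ξ b, b⟫ = ⟪fderiv ℝ T y b b ξ, ξ⟫ := by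
  have h1 : ∀ v w, fderiv ℝ T y v w = fderiv ℝ T y w v := fun v w =>
    second_derivative_symmetric_of_eventually hA hT.hasFDerivAt v w
  have hd : ∀ v w : E, HasFDerivAt (fun z => T z v w)
      (((fderiv ℝ T y).flip v).flip w) y := fun v w => by
    have h0 : HasFDerivAt (fun z => T z v) ((fderiv ℝ T y).flip v) y :=
      (hT.hasFDerivAt.clm_apply (hasFDerivAt_const v y)).congr_fderiv (by ext; simp)
    exact (h0.clm_apply (hasFDerivAt_const w y)).congr_fderiv (by ext; simp)
  have h2 : ∀ a v w, fderiv ℝ T y a v w = fderiv ℝ T y a w v := fun a v w => by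
    have := (hd v w).unique ((hd w v).congr_of_eventuallyEq (hs.mono fun z hz => hz v w))
    simpa using congrArg (fun L => L a) this
  have h3 : ∀ a u v w, ⟪fderiv ℝ T y a u v, w⟫ = ⟪fderiv ℝ T y a u w, v⟫ := fun a u v w => by
    have e : ∀ v w, HasFDerivAt (fun z => ⟪T z u v, w⟫)
        ((innerSL ℝ w).comp (((fderiv ℝ T y).flip u).flip v)) y := fun v w => by
      have := (innerSL ℝ w).hasFDerivAt.comp y (hd u v)
      refine this.congr_of_eventuallyEq (Filter.Eventually.of_forall fun z => ?_)
      simp [real_inner_comm]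
    have := (e v w).unique ((e w v).congr_of_eventuallyEq (hsi.mono fun z hz => hz u v w))
    have := congrArg (fun L => L a) this
    simpa [real_inner_comm] using this
  rw [h2 ξ ξ b, h1 ξ b, h3 b ξ ξ b, h2 b ξ b]

/-- The quadratic form touching the equation from above at a point. -/
lemma isLocalMin_of_equation {G : E → ℝ} {A U : E → E →L[ℝ] E} {r : ι → E → E} {y : E}
    (hsymm : ∀ᶠ z in 𝓝 y, ∀ v w, ⟪A z v, w⟫ = ⟪A z w, v⟫)
    (hpos : ∀ᶠ z in 𝓝 y, ∀ v, 0 ≤ ⟪A z v, v⟫) (hU : ∀ᶠ z in 𝓝 y, ∀ v, A z (U z v) = v)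
    (heq : ∀ᶠ z in 𝓝 y, G z = ∑ k, ⟪r k z, U z (r k z)⟫) :
    IsLocalMin (fun z => G z - 2 * ∑ k, ⟪r k z, U y (r k y)⟫ +
      ∑ k, ⟪A z (U y (r k y)), U y (r k y)⟫) y := by
  have key : ∀ z, (∀ v w, ⟪A z v, w⟫ = ⟪A z w, v⟫) → (∀ v, A z (U z v) = v) →
      G z = ∑ k, ⟪r k z, U z (r k z)⟫ → ∀ b : ι → E,
      G z - 2 * ∑ k, ⟪r k z, b k⟫ + ∑ k, ⟪A z (b k), b k⟫ =
        ∑ k, ⟪A z (U z (r k z) - b k), U z (r k z) - b k⟫ := fun z hs hu he b => by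
    rw [he, Finset.mul_sum, ← Finset.sum_sub_distrib, ← Finset.sum_add_distrib]
    refine Finset.sum_congr rfl fun k _ => ?_
    have h1 : ⟪A z (b k), U z (r k z)⟫ = ⟪r k z, b k⟫ := by rw [hs, hu]
    rw [map_sub, hu, inner_sub_left, inner_sub_right, inner_sub_right, h1]
    ring
  have h0 := key y hsymm.self_of_nhds hU.self_of_nhds heq.self_of_nhds (fun k => U y (r k y))
  filter_upwards [hsymm, hpos, hU, heq] with z h1 h2 h3 h4
  have hz := key z h1 h3 h4 (fun k => U y (r k y))
  rw [h0, hz]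
  simp only [sub_self, map_zero, inner_zero_left, Finset.sum_const_zero]
  exact Finset.sum_nonneg fun k _ => h2 _

/-- The dual equation `∑ₖ ⟪rₖ, A⁻¹ rₖ⟫ = F (X, ·)` yields the structural inequalities. -/
lemma dualSolution_of_equation [CompleteSpace E] [Nonempty ι] {Ω D : Set E} (hDo : IsOpen D)
    {X : E → E} {A U : E → E →L[ℝ] E} {T : E → E →L[ℝ] E →L[ℝ] E} {F : E × E → ℝ}
    {r : ι → E → E} {ε K R Λ a₀ : ℝ} (hR : 0 < R) (hΛ : 0 ≤ Λ) (ha₀ : 0 < a₀)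
    (hX : ∀ y ∈ closure D, HasFDerivWithinAt X (A y) (closure D) y)
    (hA : ∀ y ∈ closure D, HasFDerivWithinAt A (T y) (closure D) y)
    (hT : ∀ y ∈ D, DifferentiableAt ℝ T y)
    (symm_A : ∀ y ∈ closure D, ∀ v w, ⟪A y v, w⟫ = ⟪A y w, v⟫)
    (pos_A : ∀ y ∈ closure D, ∀ v, v ≠ 0 → 0 < ⟪A y v, v⟫)
    (symm_T : ∀ y ∈ closure D, ∀ v w, T y v w = T y w v)
    (symm_T_inner : ∀ y ∈ closure D, ∀ u v w, ⟪T y u v, w⟫ = ⟪T y u w, v⟫)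
    (mapsTo : ∀ y ∈ D, X y ∈ Ω) (mapsTo_frontier : ∀ y ∈ frontier D, X y ∈ frontier Ω)
    (hF : ∀ y ∈ D, ContDiffAt ℝ 2 F (X y, y))
    (hF1 : ∀ y ∈ D, ‖fderiv ℝ F (X y, y)‖ ≤ K)
    (hF2 : ∀ y ∈ D, ‖fderiv ℝ (fderiv ℝ F) (X y, y)‖ ≤ K)
    (hFx : ∀ y ∈ D, ‖(fderiv ℝ F (X y, y)).comp (ContinuousLinearMap.inl ℝ E E)‖ ≤ ε)
    (hFxx : ∀ y ∈ D, ∀ a, fderiv ℝ (fderiv ℝ F) (X y, y) (a, 0) (a, 0) ≤ 0)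
    (hFxp : ∀ y ∈ D, ∀ p a, fderiv ℝ (fderiv ℝ F) (X y, y) (0, p) (a, 0) ≤ ε * ‖p‖ * ‖a‖)
    (hr : ∀ y ∈ D, ∀ k, ContDiffAt ℝ 2 (r k) y) (hr0 : ∀ y ∈ D, ∀ k, ‖r k y‖ ≤ R)
    (hr1 : ∀ y ∈ D, ∀ k, ‖fderiv ℝ (r k) y‖ ≤ R)
    (hr2 : ∀ y ∈ D, ∀ k, ‖fderiv ℝ (fderiv ℝ (r k)) y‖ ≤ R)
    (hU : ∀ y ∈ D, ∀ v, A y (U y v) = v) (hUΛ : ∀ y ∈ D, ∀ v, ‖U y v‖ ≤ Λ * ‖v‖)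
    (heq : ∀ y ∈ D, F (X y, y) = ∑ k, ⟪r k y, U y (r k y)⟫) (ha : ∀ y ∈ D, a₀ ≤ F (X y, y)) :
    DualSolution Ω D ε ((a₀ / R) ^ 2 / Fintype.card ι) (Λ * R) R
      (K + 2 * (Fintype.card ι * (R * (Λ * R)))) (K + 2 * (Fintype.card ι * (R * (Λ * R)))) X A T
      (fun y k => U y (r k y))
      (fun y => (InnerProductSpace.toDual ℝ E).symm
        ((fderiv ℝ F (X y, y)).comp (ContinuousLinearMap.inl ℝ E E))) := by
  have hb : ∀ y ∈ D, ∀ k, ‖U y (r k y)‖ ≤ Λ * R := fun y hy k =>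
    (hUΛ y hy _).trans (mul_le_mul_of_nonneg_left (hr0 y hy k) hΛ)
  have ev : ∀ {p : E → Prop} {y : E}, y ∈ D → (∀ z ∈ D, p z) → ∀ᶠ z in 𝓝 y, p z :=
    fun hy hp => Filter.eventually_of_mem (hDo.mem_nhds hy) hp
  have hcl : ∀ y ∈ D, y ∈ closure D := fun y hy => subset_closure hy
  have hnhds : ∀ y ∈ D, closure D ∈ 𝓝 y := fun y hy =>
    Filter.mem_of_superset (hDo.mem_nhds hy) subset_closure
  have hA' : ∀ y ∈ D, HasFDerivAt A (T y) y := fun y hy =>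
    (hA y (hcl y hy)).hasFDerivAt (hnhds y hy)
  have hlin := fun y (hy : y ∈ D) => linearized_of_isLocalMin (b := fun k => U y (r k y)) (hF y hy)
    (ev hy fun z hz => (hX z (hcl z hz)).hasFDerivAt (hnhds z hz)) (ev hy hA') (hT y hy) (hr y hy)
    (isLocalMin_of_equation (G := fun z => F (X z, z)) (ev hy fun z hz => symm_A z (hcl z hz))
      (ev hy fun z hz v => by
        rcases eq_or_ne v 0 with rfl | hv
        · simp
        · exact (pos_A z (hcl z hz) v hv).le) (ev hy hU) (ev hy heq))
  set g : E → E := fun y => (InnerProductSpace.toDual ℝ E).symm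
    ((fderiv ℝ F (X y, y)).comp (ContinuousLinearMap.inl ℝ E E)) with hgdef
  have hg : ∀ y a, fderiv ℝ F (X y, y) (a, 0) = ⟪g y, a⟫ := fun y a => by
    rw [hgdef, InnerProductSpace.toDual_symm_apply]; simp
  have hsum : ∀ s : ι → ℝ, (∀ k, |s k| ≤ R * (Λ * R)) →
      |∑ k, s k| ≤ Fintype.card ι * (R * (Λ * R)) := fun s hs => by
    refine (Finset.abs_sum_le_sum_abs _ _).trans
      ((Finset.sum_le_card_nsmul _ _ _ fun k _ => hs k).trans ?_)
    simp
  refine ⟨hX, hA, hT, symm_A, pos_A, symm_T, symm_T_inner, mapsTo, mapsTo_frontier, hb, ?_, ?_,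
    fun y hy k => by rw [hU y hy]; exact hr0 y hy k, ?_, ?_⟩
  · intro y hy
    have h1 : a₀ ≤ R * ∑ k, ‖U y (r k y)‖ := by
      refine (ha y hy).trans ?_
      rw [heq y hy, Finset.mul_sum]
      exact Finset.sum_le_sum fun k _ => (real_inner_le_norm _ _).trans
        (mul_le_mul_of_nonneg_right (hr0 y hy k) (norm_nonneg _))
    have h2 : a₀ / R ≤ ∑ k, ‖U y (r k y)‖ := by rwa [div_le_iff₀' hR]
    have h3 := sq_sum_le_card_mul_sum_sq (s := Finset.univ) (f := fun k => ‖U y (r k y)‖)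
    rw [div_le_iff₀' (by exact_mod_cast Fintype.card_pos)]
    exact (pow_le_pow_left₀ (by positivity) h2 2).trans h3
  · intro y hy
    rw [hgdef, LinearIsometryEquiv.norm_map]
    exact hFx y hy
  · intro y hy
    set S := ∑ k, T y (U y (r k y)) (U y (r k y)) + A y (g y) with hS
    have h1 := (hlin y hy S).1
    have e1 : ⟪S, S⟫ = ∑ k, ⟪T y S (U y (r k y)), U y (r k y)⟫ + ⟪g y, A y S⟫ := by
      conv_lhs => rw [hS, inner_add_left, sum_inner]
      rw [symm_A y (hcl y hy) (g y), real_inner_comm]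
      congr 1
      refine Finset.sum_congr rfl fun k _ => ?_
      rw [← hS, symm_T_inner y (hcl y hy), symm_T y (hcl y hy)]
    have e2 : fderiv ℝ F (X y, y) (A y S, S) =
        ⟪g y, A y S⟫ + fderiv ℝ F (X y, y) (0, S) := by
      rw [← hg, ← map_add]; simp
    have b1 : |fderiv ℝ F (X y, y) (0, S)| ≤ K * ‖S‖ := by
      refine ((fderiv ℝ F (X y, y)).le_opNorm _).trans ?_
      rw [Prod.norm_def]
      simp only [norm_zero, norm_nonneg, sup_of_le_right]
      exact mul_le_mul_of_nonneg_right (hF1 y hy) (norm_nonneg _)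
    have b2 : |∑ k, ⟪fderiv ℝ (r k) y S, U y (r k y)⟫| ≤
        Fintype.card ι * (R * (Λ * R)) * ‖S‖ := by
      refine (Finset.abs_sum_le_sum_abs _ _).trans
        ((Finset.sum_le_card_nsmul _ _ (R * (Λ * R) * ‖S‖) fun k _ => ?_).trans ?_)
      · refine (abs_real_inner_le_norm _ _).trans ?_
        have := (fderiv ℝ (r k) y).le_of_opNorm_le (hr1 y hy k) S
        calc _ ≤ (R * ‖S‖) * (Λ * R) :=
              mul_le_mul this (hb y hy k) (norm_nonneg _) (by positivity)
          _ = _ := by ring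
      · simp [mul_assoc]
    have h2 : ‖S‖ * ‖S‖ ≤ (K + 2 * (Fintype.card ι * (R * (Λ * R)))) * ‖S‖ := by
      rw [← real_inner_self_eq_norm_mul_norm, e1]
      rw [e2] at h1
      have := abs_le.1 b1
      have := abs_le.1 b2
      linarith
    rcases (norm_nonneg S).eq_or_lt with h0 | h0
    · rw [← h0]
      have hK : 0 ≤ K := (norm_nonneg _).trans (hF1 y hy)
      positivity
    · exact le_of_mul_le_mul_right h2 h0
  · intro y hy ξ hξ
    have h1 := (hlin y hy ξ).2
    have hK : 0 ≤ K := (norm_nonneg _).trans (hF1 y hy)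
    have hε : 0 ≤ ε := (norm_nonneg _).trans (hFx y hy)
    have e1 : ∀ k, ⟪fderiv ℝ T y ξ ξ (U y (r k y)), U y (r k y)⟫ =
        ⟪fderiv ℝ T y (U y (r k y)) (U y (r k y)) ξ, ξ⟫ := fun k =>
      inner_fderiv_third_comm (ev hy hA') (hT y hy) (ev hy fun z hz => symm_T z (hcl z hz))
        (ev hy fun z hz => symm_T_inner z (hcl z hz)) ξ _
    have e2 : fderiv ℝ F (X y, y) (T y ξ ξ, 0) = ⟪T y (g y) ξ, ξ⟫ := by
      rw [hg, real_inner_comm, symm_T_inner y (hcl y hy), symm_T y (hcl y hy)]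
    have hsy : ∀ v w, fderiv ℝ (fderiv ℝ F) (X y, y) v w = fderiv ℝ (fderiv ℝ F) (X y, y) w v :=
      fun v w => second_derivative_symmetric_of_eventually (hF y hy).eventually_hasFDerivAt
        (hF y hy).hasFDerivAt_fderiv v w
    have e3 : fderiv ℝ (fderiv ℝ F) (X y, y) (A y ξ, ξ) (A y ξ, ξ) =
        fderiv ℝ (fderiv ℝ F) (X y, y) (A y ξ, 0) (A y ξ, 0) +
        2 * fderiv ℝ (fderiv ℝ F) (X y, y) (0, ξ) (A y ξ, 0) +
        fderiv ℝ (fderiv ℝ F) (X y, y) (0, ξ) (0, ξ) := by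
      have : (A y ξ, ξ) = (A y ξ, (0 : E)) + ((0 : E), ξ) := by simp
      rw [this]
      simp only [map_add, _root_.add_apply]
      rw [hsy (A y ξ, 0) (0, ξ)]
      ring
    have b1 : fderiv ℝ (fderiv ℝ F) (X y, y) (0, ξ) (0, ξ) ≤ K := by
      have h2 := (fderiv ℝ (fderiv ℝ F) (X y, y)).le_opNorm₂ (0, ξ) (0, ξ)
      have h3 : ‖((0 : E), ξ)‖ = ‖ξ‖ := by simp [Prod.norm_def]
      rw [h3] at h2
      refine (le_abs_self _).trans (h2.trans ?_)
      calc _ ≤ K * 1 * 1 := by gcongr; exact hF2 y hy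
        _ = K := by ring
    have b2 := hFxp y hy ξ (A y ξ)
    have b3 : ε * ‖ξ‖ * ‖A y ξ‖ ≤ ε * ‖A y ξ‖ := by
      have := mul_le_mul_of_nonneg_left hξ (by positivity : 0 ≤ ε * ‖A y ξ‖)
      linarith
    have b4 : |∑ k, ⟪fderiv ℝ (fderiv ℝ (r k)) y ξ ξ, U y (r k y)⟫| ≤
        Fintype.card ι * (R * (Λ * R)) := by
      refine hsum _ fun k => (abs_real_inner_le_norm _ _).trans ?_
      refine mul_le_mul ?_ (hb y hy k) (norm_nonneg _) hR.le
      refine ((fderiv ℝ (fderiv ℝ (r k)) y).le_opNorm₂ ξ ξ).trans ?_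
      calc _ ≤ R * 1 * 1 := by gcongr; exact hr2 y hy k
        _ = R := by ring
    have b5 := hFxx y hy (A y ξ)
    simp only [e1, e2, e3] at h1
    have := abs_le.1 b4
    linarith

end DualEquation

section Translation

lemma Hess_apply (u : Euc n → ℝ) (x : Euc n) (i j : Fin n) :
    Hess u x i j = fderiv ℝ (fderiv ℝ u) x (EuclideanSpace.single i 1)
      (EuclideanSpace.single j 1) := by
  simp [Hess, iteratedFDeriv_two_apply]

lemma inner_fderiv_gradient {E : Type*} [NormedAddCommGroup E] [InnerProductSpace ℝ E]
    [CompleteSpace E] (u : E → ℝ) (x v w : E) :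
    ⟪fderiv ℝ (gradient u) x v, w⟫ = fderiv ℝ (fderiv ℝ u) x v w := by
  have h : gradient u = (InnerProductSpace.toDual ℝ E).symm ∘ fderiv ℝ u := rfl
  rw [h, LinearIsometryEquiv.comp_fderiv]
  exact InnerProductSpace.toDual_symm_apply

lemma euc_eq_sum (ξ : Euc n) : ξ = ∑ i, ξ i • EuclideanSpace.single i (1 : ℝ) := by
  have := (EuclideanSpace.basisFun (Fin n) ℝ).sum_repr ξ
  simpa using this.symm

lemma dotProduct_Hess_mulVec (u : Euc n → ℝ) (x ξ η : Euc n) :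
    (fun i => ξ i) ⬝ᵥ (Hess u x).mulVec (fun i => η i) = ⟪fderiv ℝ (gradient u) x ξ, η⟫ := by
  rw [inner_fderiv_gradient]
  conv_rhs => rw [euc_eq_sum ξ, euc_eq_sum η]
  simp only [dotProduct, Matrix.mulVec, Hess_apply, map_sum, _root_.sum_apply, map_smul,
    _root_.smul_apply, smul_eq_mul, Finset.mul_sum]
  rw [Finset.sum_comm]
  exact Finset.sum_congr rfl fun i _ => Finset.sum_congr rfl fun j _ => by ring

/-- The vector fields whose quadratic form is the principal symbol of the Minkowski mean
curvature operator. -/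
def minkField : Option (Fin n) → Euc n → Euc n
  | some k => fun p => (√√(1 - ‖p‖ ^ 2))⁻¹ • EuclideanSpace.single k (1 : ℝ)
  | none => fun p => (√√(1 - ‖p‖ ^ 2))⁻¹ ^ 3 • p

lemma one_sub_norm_sq_pos {p : Euc n} (hp : ‖p‖ < 1) : 0 < 1 - ‖p‖ ^ 2 := by
  nlinarith [norm_nonneg p]

lemma contDiffAt_minkField (k : Option (Fin n)) {p : Euc n} (hp : ‖p‖ < 1) :
    ContDiffAt ℝ (⊤ : ℕ∞) (minkField k) p := by
  have h0 := one_sub_norm_sq_pos hp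
  have h1 : ContDiffAt ℝ (⊤ : ℕ∞) (fun p : Euc n => 1 - ‖p‖ ^ 2) p :=
    contDiffAt_const.sub (contDiff_norm_sq ℝ).contDiffAt
  have h2 : ContDiffAt ℝ (⊤ : ℕ∞) (fun p : Euc n => (√√(1 - ‖p‖ ^ 2))⁻¹) p :=
    ((h1.sqrt h0.ne').sqrt (Real.sqrt_pos.2 h0).ne').inv
      (Real.sqrt_pos.2 (Real.sqrt_pos.2 h0)).ne'
  cases k with
  | some k => exact h2.smul contDiffAt_const
  | none => exact (h2.pow 3).smul contDiffAt_id

lemma sum_minkField (p : Euc n) (U : Euc n →L[ℝ] Euc n) :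
    ∑ k, ⟪minkField k p, U (minkField k p)⟫ =
      (√(1 - ‖p‖ ^ 2))⁻¹ * ∑ i, ⟪U (EuclideanSpace.single i (1 : ℝ)), EuclideanSpace.single i 1⟫ +
        (√(1 - ‖p‖ ^ 2))⁻¹ ^ 3 * ⟪U p, p⟫ := by
  have ha : (√√(1 - ‖p‖ ^ 2))⁻¹ * (√√(1 - ‖p‖ ^ 2))⁻¹ = (√(1 - ‖p‖ ^ 2))⁻¹ := by
    rw [← mul_inv, Real.mul_self_sqrt (Real.sqrt_nonneg _)]
  rw [Fintype.sum_option, add_comm]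
  simp only [minkField, map_smul, inner_smul_left, inner_smul_right, Finset.mul_sum]
  congr 1
  · refine Finset.sum_congr rfl fun i _ => ?_
    rw [real_inner_comm, ← ha]
    simp [mul_assoc]
  · rw [real_inner_comm, ← ha]
    simp only [map_pow, conj_trivial]
    ring

lemma minkDiv_eq {u : Euc n → ℝ} {x : Euc n} (hu : DifferentiableAt ℝ (gradient u) x)
    (h1 : ‖gradient u x‖ < 1) :
    MinkDiv u x = ∑ k, ⟪minkField k (gradient u x),
      fderiv ℝ (gradient u) x (minkField k (gradient u x))⟫ := by
  set V := gradient u with hV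
  set U := fderiv ℝ V x with hU
  have h0 := one_sub_norm_sq_pos h1
  have hs : 0 < √(1 - ‖V x‖ ^ 2) := Real.sqrt_pos.2 h0
  have d1 : HasFDerivAt (fun y => 1 - ‖V y‖ ^ 2) (-(2 • (innerSL ℝ (V x)).comp U)) x :=
    (hu.hasFDerivAt.norm_sq).const_sub 1
  have d2 : HasFDerivAt (fun y => (√(1 - ‖V y‖ ^ 2))⁻¹) (-(√(1 - ‖V x‖ ^ 2) ^ 2)⁻¹ •
      (1 / (2 * √(1 - ‖V x‖ ^ 2))) • (-(2 • (innerSL ℝ (V x)).comp U) : Euc n →L[ℝ] ℝ)) x :=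
    (hasDerivAt_inv hs.ne').comp_hasFDerivAt x (d1.sqrt h0.ne')
  have d3 : ∀ i, HasFDerivAt (fun y => V y i) ((EuclideanSpace.proj (𝕜 := ℝ) i).comp U) x := fun i =>
    (EuclideanSpace.proj (𝕜 := ℝ) i : Euc n →L[ℝ] ℝ).hasFDerivAt.comp x hu.hasFDerivAt
  have hterm : ∀ i, fderiv ℝ (fun y => (√(1 - ‖V y‖ ^ 2))⁻¹ * V y i) x
      (EuclideanSpace.single i 1) =
      (√(1 - ‖V x‖ ^ 2))⁻¹ * ⟪U (EuclideanSpace.single i (1 : ℝ)), EuclideanSpace.single i 1⟫ +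
        (√(1 - ‖V x‖ ^ 2))⁻¹ ^ 3 * (V x i * ⟪U (EuclideanSpace.single i (1 : ℝ)), V x⟫) := fun i => by
    rw [(d2.fun_mul (d3 i)).fderiv]
    have e : (√(1 - ‖V x‖ ^ 2))⁻¹ ^ 3 = (√(1 - ‖V x‖ ^ 2) ^ 2)⁻¹ * (√(1 - ‖V x‖ ^ 2))⁻¹ := by
      rw [← inv_pow]; ring
    rw [e]
    simp [EuclideanSpace.inner_single_right, real_inner_comm]
    ring
  rw [sum_minkField, MinkDiv, ← hV, Finset.sum_congr rfl fun i _ => hterm i,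
    Finset.sum_add_distrib, ← Finset.mul_sum, ← Finset.mul_sum]
  congr 2
  conv_rhs => rw [real_inner_comm]; rhs; rhs; rw [euc_eq_sum (V x)]
  rw [map_sum, inner_sum]
  simp [inner_smul_right, real_inner_comm]

end Translation

section LinearAlgebra

lemma inner_self_le_trace {U : Euc n →L[ℝ] Euc n} (hs : ∀ v w, ⟪U v, w⟫ = ⟪U w, v⟫)
    (hp : ∀ v, 0 ≤ ⟪U v, v⟫) {v : Euc n} (hv : ‖v‖ ≤ 1) :
    ⟪U v, v⟫ ≤ ∑ i, ⟪U (EuclideanSpace.single i (1 : ℝ)), EuclideanSpace.single i 1⟫ := by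
  have h1 : ∀ i, 2 * (v i * ⟪U (EuclideanSpace.single i (1 : ℝ)), v⟫) ≤
      ⟪U (EuclideanSpace.single i (1 : ℝ)), EuclideanSpace.single i 1⟫ + v i ^ 2 * ⟪U v, v⟫ :=
    fun i => by
      have := hp (EuclideanSpace.single i (1 : ℝ) - v i • v)
      rw [map_sub, map_smul, inner_sub_left, inner_sub_right, inner_sub_right, inner_smul_left,
        inner_smul_right, inner_smul_left, inner_smul_right,
        hs v (EuclideanSpace.single i (1 : ℝ))] at this
      simp only [conj_trivial] at this
      linarith
  have h2 : ⟪U v, v⟫ = ∑ i, v i * ⟪U (EuclideanSpace.single i (1 : ℝ)), v⟫ := by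
    conv_lhs => lhs; rw [euc_eq_sum v]
    simp [map_sum, sum_inner, inner_smul_left]
  have h3 : ∑ i, v i ^ 2 = ‖v‖ ^ 2 := by
    rw [EuclideanSpace.norm_sq_eq]; simp
  have h4 := Finset.sum_le_sum fun i (_ : i ∈ Finset.univ) => h1 i
  rw [← Finset.mul_sum, ← h2, Finset.sum_add_distrib, ← Finset.sum_mul, h3] at h4
  have h5 : ‖v‖ ^ 2 * ⟪U v, v⟫ ≤ ⟪U v, v⟫ :=
    mul_le_of_le_one_left (hp v) (pow_le_one₀ (norm_nonneg _) hv)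
  linarith

lemma trace_nonneg {U : Euc n →L[ℝ] Euc n} (hp : ∀ v, 0 ≤ ⟪U v, v⟫) :
    0 ≤ ∑ i, ⟪U (EuclideanSpace.single i (1 : ℝ)), EuclideanSpace.single i 1⟫ :=
  Finset.sum_nonneg fun _ _ => hp _

/-- The arithmetic-geometric mean inequality for the eigenvalues of a positive operator. -/
lemma abs_det_le_trace_pow (hn : 0 < n) {U : Euc n →L[ℝ] Euc n}
    (hs : ∀ v w, ⟪U v, w⟫ = ⟪U w, v⟫) (hp : ∀ v, 0 ≤ ⟪U v, v⟫) :
    |U.det| ≤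
      ((∑ i, ⟪U (EuclideanSpace.single i (1 : ℝ)), EuclideanSpace.single i 1⟫) / n) ^ n := by
  have hT : (U : Euc n →ₗ[ℝ] Euc n).IsSymmetric := fun v w => by
    rw [real_inner_comm _ v]; exact hs v w
  have hd : Module.finrank ℝ (Euc n) = n := by simp
  have hnn : ∀ i, 0 ≤ hT.eigenvalues hd i := fun i => by
    have h1 := hp (hT.eigenvectorBasis hd i)
    have h2 := hT.apply_eigenvectorBasis hd i
    rw [ContinuousLinearMap.coe_coe] at h2
    rw [h2, inner_smul_left, real_inner_self_eq_norm_sq] at h1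
    simpa using h1
  have e1 : U.det = ∏ i, hT.eigenvalues hd i := hT.det_eq_prod_eigenvalues hd
  have e2 : ∑ i, ⟪U (EuclideanSpace.single i (1 : ℝ)), EuclideanSpace.single i 1⟫ =
      ∑ i, hT.eigenvalues hd i := by
    have h1 := LinearMap.trace_eq_sum_inner (U : Euc n →ₗ[ℝ] Euc n)
      (EuclideanSpace.basisFun (Fin n) ℝ)
    rw [hT.trace_eq_sum_eigenvalues hd] at h1
    simp only [EuclideanSpace.basisFun_apply, ContinuousLinearMap.coe_coe] at h1
    rw [Finset.sum_congr rfl fun i _ => real_inner_comm _ _]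
    exact h1.symm
  have hn0 : (0 : ℝ) < n := by exact_mod_cast hn
  have amgm := Real.geom_mean_le_arith_mean Finset.univ (fun _ => (1 : ℝ))
    (hT.eigenvalues hd) (fun _ _ => zero_le_one) (by simpa using hn) (fun i _ => hnn i)
  simp only [Real.rpow_one, one_mul, Finset.sum_const, Finset.card_univ, Fintype.card_fin,
    nsmul_eq_mul, mul_one] at amgm
  have hP : 0 ≤ ∏ i, hT.eigenvalues hd i := Finset.prod_nonneg fun i _ => hnn i
  rw [e1, e2, abs_of_nonneg hP]
  have h3 := pow_le_pow_left₀ (Real.rpow_nonneg hP _) amgm n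
  rwa [Real.rpow_inv_natCast_pow hP hn.ne'] at h3

lemma inner_self_le_of_MatLE {u : Euc n → ℝ} {x : Euc n} {θ : ℝ}
    (h : MatLE (Hess u x) ((-θ) • (1 : Matrix (Fin n) (Fin n) ℝ))) (v : Euc n) :
    ⟪fderiv ℝ (gradient u) x v, v⟫ ≤ -θ * ‖v‖ ^ 2 := by
  have h1 := h.dotProduct_mulVec_nonneg (fun i => v i)
  rw [Matrix.sub_mulVec, dotProduct_sub] at h1
  have h2 := dotProduct_Hess_mulVec u x v v
  have h3 : (fun i => v i) ⬝ᵥ ((-θ) • (1 : Matrix (Fin n) (Fin n) ℝ)) *ᵥ (fun i => v i) =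
      -θ * ‖v‖ ^ 2 := by
    rw [EuclideanSpace.norm_sq_eq, Matrix.smul_mulVec, Matrix.one_mulVec, dotProduct_smul]
    simp [dotProduct, sq]
  simp only [star_trivial] at h1
  rw [h2, h3] at h1
  linarith

lemma posDef_of_MatLE {A : Matrix (Fin n) (Fin n) ℝ} {δ : ℝ} (hδ : 0 < δ)
    (h : MatLE (δ • (1 : Matrix (Fin n) (Fin n) ℝ)) A) : A.PosDef := by
  have h1 : (δ • (1 : Matrix (Fin n) (Fin n) ℝ)).PosDef := Matrix.PosDef.one.smul hδ
  have := h1.add_posSemidef h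
  rwa [add_sub_cancel] at this

lemma inner_fderiv_gradient_comm_of_isHermitian {u : Euc n → ℝ} {x : Euc n}
    (h : (Hess u x).IsHermitian) (v w : Euc n) :
    ⟪fderiv ℝ (gradient u) x v, w⟫ = ⟪fderiv ℝ (gradient u) x w, v⟫ := by
  rw [← dotProduct_Hess_mulVec, ← dotProduct_Hess_mulVec, dotProduct_comm,
    ← Matrix.vecMul_transpose, ← dotProduct_mulVec]
  congr 2

lemma inner_fderiv_gradient_pos_of_posDef {u : Euc n → ℝ} {x : Euc n} (h : (Hess u x).PosDef)
    {v : Euc n} (hv : v ≠ 0) : 0 < ⟪fderiv ℝ (gradient u) x v, v⟫ := by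
  rw [← dotProduct_Hess_mulVec]
  have := h.dotProduct_mulVec_pos (x := fun i => v i) (fun h0 => hv (by ext i; exact congrFun h0 i))
  simpa using this

end LinearAlgebra

section Domain

set_option maxSynthPendingDepth 5

lemma convexDomain_of_hess {D : Set (Euc n)} {h : Euc n → ℝ} {θ : ℝ} (hb : Bornology.IsBounded D)
    (hne : D.Nonempty) (hc : ContDiff ℝ (⊤ : ℕ∞) h) (hD : D = {y | 0 < h y})
    (hN : ∀ y ∈ frontier D, ‖gradient h y‖ = 1) (hθ : 0 < θ)
    (hh : ∀ y : Euc n, MatLE (Hess h y) ((-θ) • (1 : Matrix (Fin n) (Fin n) ℝ))) :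
    ConvexDomain D h (gradient h) θ where
  pos := hθ
  bounded := hb
  nonempty := hne
  eq_setOf := hD
  contDiff_grad := (InnerProductSpace.toDual ℝ (Euc n)).symm.contDiff.comp
    (hc.fderiv_right (m := 2)
      (WithTop.coe_le_coe.2 (le_top : (2 + 1 : ℕ∞) ≤ ⊤)))
  hasFDerivAt := fun y => by
    have := ((hc.differentiable (by simp)) y).hasGradientAt.hasFDerivAt
    exact this.congr_fderiv (by ext; simp)
  norm_grad := hN
  concave := fun y v => inner_self_le_of_MatLE (hh y) v

lemma exists_minkField_bound {D : Set (Euc n)} (hb : Bornology.IsBounded D)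
    (hball : closure D ⊆ Metric.ball 0 1) :
    ∃ R : ℝ, 1 ≤ R ∧ ∀ y ∈ closure D, ∀ k : Option (Fin n), ‖minkField k y‖ ≤ R ∧
      ‖fderiv ℝ (minkField k) y‖ ≤ R ∧ ‖fderiv ℝ (fderiv ℝ (minkField k)) y‖ ≤ R := by
  have hc : IsCompact (closure D) := hb.isCompact_closure
  have key : ∀ k : Option (Fin n), ∃ R : ℝ, ∀ y ∈ closure D, ‖minkField k y‖ ≤ R ∧
      ‖fderiv ℝ (minkField k) y‖ ≤ R ∧ ‖fderiv ℝ (fderiv ℝ (minkField k)) y‖ ≤ R := fun k => by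
    have h0 : ContDiffOn ℝ 3 (minkField k) (Metric.ball (0 : Euc n) 1) := fun y hy =>
      ((contDiffAt_minkField k (by simpa using hy)).of_le
        ENat.LEInfty.out).contDiffWithinAt
    have h1 : ContDiffOn ℝ 2 (fderiv ℝ (minkField k)) (Metric.ball (0 : Euc n) 1) :=
      h0.fderiv_of_isOpen Metric.isOpen_ball (by norm_num)
    have h2 : ContDiffOn ℝ 1 (fderiv ℝ (fderiv ℝ (minkField k))) (Metric.ball (0 : Euc n) 1) :=
      h1.fderiv_of_isOpen Metric.isOpen_ball (by norm_num)
    obtain ⟨a, ha⟩ := hc.exists_bound_of_continuousOn (h0.continuousOn.mono hball)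
    obtain ⟨b, hb⟩ := hc.exists_bound_of_continuousOn (h1.continuousOn.mono hball)
    obtain ⟨c, hc⟩ := hc.exists_bound_of_continuousOn (h2.continuousOn.mono hball)
    refine ⟨max a (max b c), fun y hy => ⟨?_, ?_, ?_⟩⟩
    · exact (ha y hy).trans (le_max_left _ _)
    · exact (hb y hy).trans ((le_max_left _ _).trans (le_max_right _ _))
    · exact (hc y hy).trans ((le_max_right _ _).trans (le_max_right _ _))
  choose R hR using key
  refine ⟨1 + ∑ k, |R k|, le_add_of_nonneg_right (Finset.sum_nonneg fun _ _ => abs_nonneg _),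
    fun y hy k => ?_⟩
  have h1 : R k ≤ 1 + ∑ k, |R k| := by
    have := Finset.single_le_sum (f := fun k => |R k|) (fun _ _ => abs_nonneg _)
      (Finset.mem_univ k)
    have := le_abs_self (R k)
    linarith
  exact ⟨(hR k y hy).1.trans h1, (hR k y hy).2.1.trans h1, (hR k y hy).2.2.trans h1⟩

end Domain

section LegendrePair

set_option maxSynthPendingDepth 5

lemma differentiableAt_gradient_of_posDef {u : Euc n → ℝ} {x : Euc n} (hn : 0 < n)
    (h : (Hess u x).PosDef) : DifferentiableAt ℝ (gradient u) x := by
  by_contra hd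
  have hne : EuclideanSpace.single (⟨0, hn⟩ : Fin n) (1 : ℝ) ≠ 0 := by simp
  have := inner_fderiv_gradient_pos_of_posDef h hne
  rw [fderiv_zero_of_not_differentiableAt hd] at this
  simp at this

/-- A uniformly convex function on `closure Ω` and its Legendre transform on `closure D`. -/
structure LegendrePair (Ω D : Set (Euc n)) (u ut : Euc n → ℝ) : Prop where
  pos_dim : 0 < n
  isOpen_left : IsOpen Ω
  isOpen_right : IsOpen D
  isCompact_closure_left : IsCompact (closure Ω)
  convex_right : Convex ℝ D
  nonempty_right : D.Nonempty
  posDef : ∀ x ∈ closure Ω, (Hess u x).PosDef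
  image_gradient : gradient u '' Ω = D
  contDiffOn : ContDiffOn ℝ (⊤ : ℕ∞) ut (closure D)
  gradient_gradient : ∀ x ∈ closure Ω, gradient ut (gradient u x) = x
  hess_gradient : ∀ x ∈ closure Ω, Hess ut (gradient u x) = (Hess u x)⁻¹

namespace LegendrePair

variable {Ω D : Set (Euc n)} {u ut : Euc n → ℝ}

lemma differentiableAt_left (L : LegendrePair Ω D u ut) {x : Euc n} (hx : x ∈ closure Ω) :
    DifferentiableAt ℝ (gradient u) x :=
  differentiableAt_gradient_of_posDef L.pos_dim (L.posDef x hx)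

lemma continuousOn_left (L : LegendrePair Ω D u ut) : ContinuousOn (gradient u) (closure Ω) :=
  fun _ hx => (L.differentiableAt_left hx).continuousAt.continuousWithinAt

lemma closure_subset_image (L : LegendrePair Ω D u ut) :
    closure D ⊆ gradient u '' closure Ω := by
  refine closure_minimal ?_ (L.isCompact_closure_left.image_of_continuousOn
    L.continuousOn_left).isClosed
  rw [← L.image_gradient]
  exact image_mono subset_closure

lemma mem_closure (L : LegendrePair Ω D u ut) {y : Euc n} (hy : y ∈ closure D) :
    gradient ut y ∈ closure Ω ∧ gradient u (gradient ut y) = y := by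
  obtain ⟨x, hx, rfl⟩ := L.closure_subset_image hy
  rw [L.gradient_gradient x hx]
  exact ⟨hx, rfl⟩

lemma mem_left (L : LegendrePair Ω D u ut) {y : Euc n} (hy : y ∈ D) : gradient ut y ∈ Ω := by
  rw [← L.image_gradient] at hy
  obtain ⟨x, hx, rfl⟩ := hy
  rwa [L.gradient_gradient x (subset_closure hx)]

lemma mem_frontier_left (L : LegendrePair Ω D u ut) {y : Euc n} (hy : y ∈ frontier D) :
    gradient ut y ∈ frontier Ω := by
  have h1 := L.mem_closure (frontier_subset_closure hy)
  rw [L.isOpen_left.frontier_eq]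
  refine ⟨h1.1, fun h2 => ?_⟩
  rw [L.isOpen_right.frontier_eq] at hy
  refine hy.2 ?_
  rw [← L.image_gradient]
  exact ⟨_, h2, h1.2⟩

lemma posDef_right (L : LegendrePair Ω D u ut) {y : Euc n} (hy : y ∈ closure D) :
    (Hess ut y).PosDef := by
  obtain ⟨x, hx, rfl⟩ := L.closure_subset_image hy
  rw [L.hess_gradient x hx]
  exact (L.posDef x hx).inv

lemma differentiableAt_right (L : LegendrePair Ω D u ut) {y : Euc n} (hy : y ∈ closure D) :
    DifferentiableAt ℝ (gradient ut) y :=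
  differentiableAt_gradient_of_posDef L.pos_dim (L.posDef_right hy)

lemma closure_mem_nhds (L : LegendrePair Ω D u ut) {y : Euc n} (hy : y ∈ D) : closure D ∈ 𝓝 y :=
  Filter.mem_of_superset (L.isOpen_right.mem_nhds hy) subset_closure

lemma closure_subset_closure_interior (L : LegendrePair Ω D u ut) :
    closure D ⊆ closure (interior (closure D)) :=
  closure_mono (interior_maximal subset_closure L.isOpen_right)

lemma uniqueDiffOn (L : LegendrePair Ω D u ut) : UniqueDiffOn ℝ (closure D) :=
  uniqueDiffOn_convex L.convex_right.closure
    (L.nonempty_right.mono (interior_maximal subset_closure L.isOpen_right))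

lemma fderiv_eq_fderivWithin (L : LegendrePair Ω D u ut) :
    EqOn (fderiv ℝ ut) (fderivWithin ℝ ut (closure D)) (closure D) := by
  have h0 : EqOn (fderiv ℝ ut) (fderivWithin ℝ ut (closure D)) D := fun y hy =>
    (fderivWithin_of_mem_nhds (L.closure_mem_nhds hy)).symm
  refine h0.of_subset_closure ?_ ?_ subset_closure subset_rfl
  · intro y hy
    have h1 : fderiv ℝ ut = InnerProductSpace.toDual ℝ (Euc n) ∘ gradient ut := by
      ext1 z; simp [gradient]
    rw [h1]
    exact ((InnerProductSpace.toDual ℝ (Euc n)).continuous.continuousAt.comp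
      (L.differentiableAt_right hy).continuousAt).continuousWithinAt
  · exact L.contDiffOn.continuousOn_fderivWithin L.uniqueDiffOn (by simp)

lemma contDiffOn_gradient (L : LegendrePair Ω D u ut) :
    ContDiffOn ℝ (⊤ : ℕ∞) (gradient ut) (closure D) := by
  have h1 : ContDiffOn ℝ (⊤ : ℕ∞) (fderivWithin ℝ ut (closure D)) (closure D) :=
    L.contDiffOn.fderivWithin L.uniqueDiffOn (by simp)
  refine ((InnerProductSpace.toDual ℝ (Euc n)).symm.contDiff.comp_contDiffOn h1).congr ?_
  intro y hy
  simp [gradient, L.fderiv_eq_fderivWithin hy]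

lemma fderiv_gradient_eq (L : LegendrePair Ω D u ut) :
    EqOn (fderiv ℝ (gradient ut)) (fderivWithin ℝ (gradient ut) (closure D)) (closure D) :=
  fun _ hy => ((L.differentiableAt_right hy).fderivWithin (L.uniqueDiffOn _ hy)).symm

lemma contDiffOn_hess (L : LegendrePair Ω D u ut) :
    ContDiffOn ℝ (⊤ : ℕ∞) (fderiv ℝ (gradient ut)) (closure D) :=
  (L.contDiffOn_gradient.fderivWithin L.uniqueDiffOn (by simp)).congr L.fderiv_gradient_eq

lemma contDiffOn_third (L : LegendrePair Ω D u ut) :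
    ContDiffOn ℝ (⊤ : ℕ∞) (fderivWithin ℝ (fderiv ℝ (gradient ut)) (closure D)) (closure D) :=
  L.contDiffOn_hess.fderivWithin L.uniqueDiffOn (by simp)

lemma hasFDerivWithinAt_gradient (L : LegendrePair Ω D u ut) {y : Euc n} (hy : y ∈ closure D) :
    HasFDerivWithinAt (gradient ut) (fderiv ℝ (gradient ut) y) (closure D) y :=
  (L.differentiableAt_right hy).hasFDerivAt.hasFDerivWithinAt

lemma hasFDerivWithinAt_hess (L : LegendrePair Ω D u ut) {y : Euc n} (hy : y ∈ closure D) :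
    HasFDerivWithinAt (fderiv ℝ (gradient ut))
      (fderivWithin ℝ (fderiv ℝ (gradient ut)) (closure D) y) (closure D) y :=
  (L.contDiffOn_hess.differentiableOn (by simp) y hy).hasFDerivWithinAt

lemma differentiableAt_third (L : LegendrePair Ω D u ut) {y : Euc n} (hy : y ∈ D) :
    DifferentiableAt ℝ (fderivWithin ℝ (fderiv ℝ (gradient ut)) (closure D)) y :=
  (L.contDiffOn_third.differentiableOn (by simp) y (subset_closure hy)).differentiableAt
    (L.closure_mem_nhds hy)

lemma symm_hess (L : LegendrePair Ω D u ut) {y : Euc n} (hy : y ∈ closure D) (v w : Euc n) :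
    ⟪fderiv ℝ (gradient ut) y v, w⟫ = ⟪fderiv ℝ (gradient ut) y w, v⟫ :=
  inner_fderiv_gradient_comm_of_isHermitian (L.posDef_right hy).isHermitian v w

lemma symm_third (L : LegendrePair Ω D u ut) {y : Euc n} (hy : y ∈ closure D) (v w : Euc n) :
    fderivWithin ℝ (fderiv ℝ (gradient ut)) (closure D) y v w =
      fderivWithin ℝ (fderiv ℝ (gradient ut)) (closure D) y w v := by
  rw [fderivWithin_congr L.fderiv_gradient_eq (L.fderiv_gradient_eq hy)]
  exact (L.contDiffOn_gradient y hy).isSymmSndFDerivWithinAt (by simp [ENat.LEInfty.out])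
    L.uniqueDiffOn (L.closure_subset_closure_interior hy) hy v w

lemma symm_third_inner (L : LegendrePair Ω D u ut) {y : Euc n} (hy : y ∈ closure D)
    (a v w : Euc n) :
    ⟪fderivWithin ℝ (fderiv ℝ (gradient ut)) (closure D) y a v, w⟫ =
      ⟪fderivWithin ℝ (fderiv ℝ (gradient ut)) (closure D) y a w, v⟫ := by
  have e : ∀ v w : Euc n, HasFDerivWithinAt (fun z => ⟪w, fderiv ℝ (gradient ut) z v⟫)
      ((innerSL ℝ w).comp ((fderivWithin ℝ (fderiv ℝ (gradient ut)) (closure D) y).flip v))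
      (closure D) y := fun v w => by
    have h0 : HasFDerivWithinAt (fun z => fderiv ℝ (gradient ut) z v)
        ((fderivWithin ℝ (fderiv ℝ (gradient ut)) (closure D) y).flip v) (closure D) y :=
      ((L.hasFDerivWithinAt_hess hy).clm_apply (hasFDerivWithinAt_const v y _)).congr_fderiv
        (by ext; simp)
    exact (innerSL ℝ w).hasFDerivAt.comp_hasFDerivWithinAt y h0
  have h1 : ∀ z ∈ closure D, ⟪w, fderiv ℝ (gradient ut) z v⟫ = ⟪v, fderiv ℝ (gradient ut) z w⟫ :=
    fun z hz => by rw [real_inner_comm, L.symm_hess hz, real_inner_comm]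
  have h2 := (L.uniqueDiffOn y hy).eq (e v w) ((e w v).congr h1 (h1 y hy))
  have := congrArg (fun l => l a) h2
  simpa [real_inner_comm] using this

lemma hess_apply_hess (L : LegendrePair Ω D u ut) {y : Euc n} (hy : y ∈ D) (v : Euc n) :
    fderiv ℝ (gradient ut) y (fderiv ℝ (gradient u) (gradient ut y) v) = v := by
  have hx := L.mem_left hy
  have hy' : gradient u (gradient ut y) = y := (L.mem_closure (subset_closure hy)).2
  have h1 := (L.differentiableAt_left (subset_closure hx)).hasFDerivAt
  have h2 : HasFDerivAt (gradient ut) (fderiv ℝ (gradient ut) y) (gradient u (gradient ut y)) := by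
    rw [hy']; exact (L.differentiableAt_right (subset_closure hy)).hasFDerivAt
  have h3 : HasFDerivAt (gradient ut ∘ gradient u) (ContinuousLinearMap.id ℝ (Euc n))
      (gradient ut y) := (hasFDerivAt_id _).congr_of_eventuallyEq
    (Filter.eventually_of_mem (L.isOpen_left.mem_nhds hx)
      fun z hz => L.gradient_gradient z (subset_closure hz))
  exact congrArg (fun l => l v) ((h2.comp _ h1).unique h3)

end LegendrePair

end LegendrePair

section SolutionBounds

lemma ContinuousLinearMap.norm_apply_le_mul_of_inner_le {E : Type*} [NormedAddCommGroup E]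
    [InnerProductSpace ℝ E] {B : E →L[ℝ] E} {M : ℝ}
    (hsymm : ∀ v w, ⟪B v, w⟫ = ⟪B w, v⟫) (hpos : ∀ v, 0 ≤ ⟪B v, v⟫)
    (hM : ∀ v, ‖v‖ ≤ 1 → ⟪B v, v⟫ ≤ M) (v : E) : ‖B v‖ ≤ M * ‖v‖ := by
  rcases eq_or_ne v 0 with rfl | hv
  · simp
  have hv' : 0 < ‖v‖ := norm_pos_iff.2 hv
  have h1 : ‖B (‖v‖⁻¹ • v)‖ ≤ M := norm_apply_le_of_inner_le hsymm hpos hM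
    (by rw [norm_smul, norm_inv, norm_norm, inv_mul_cancel₀ hv'.ne'])
  rwa [map_smul, norm_smul, norm_inv, norm_norm, inv_mul_le_iff₀ hv', mul_comm] at h1

lemma trace_le_sum_minkField {p : Euc n} (hp : ‖p‖ < 1) {U : Euc n →L[ℝ] Euc n}
    (hU : ∀ v, 0 ≤ ⟪U v, v⟫) :
    ∑ i, ⟪U (EuclideanSpace.single i (1 : ℝ)), EuclideanSpace.single i 1⟫ ≤
      ∑ k, ⟪minkField k p, U (minkField k p)⟫ := by
  rw [sum_minkField]
  have h0 := one_sub_norm_sq_pos hp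
  have h1 : √(1 - ‖p‖ ^ 2) ≤ 1 := Real.sqrt_le_one.2 (by nlinarith [norm_nonneg p])
  have h2 : 1 ≤ (√(1 - ‖p‖ ^ 2))⁻¹ := (one_le_inv₀ (Real.sqrt_pos.2 h0)).2 h1
  have h3 := le_mul_of_one_le_left (trace_nonneg hU) h2
  have h4 : 0 ≤ (√(1 - ‖p‖ ^ 2))⁻¹ ^ 3 * ⟪U p, p⟫ := mul_nonneg (by positivity) (hU p)
  linarith

/-- Volume comparison for a gradient map with bounded trace. -/
lemma volume_ratio_le_of_trace_le (hn : 0 < n) {Ω : Set (Euc n)} (hΩ : IsOpen Ω)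
    (hne : Ω.Nonempty) (hb : Bornology.IsBounded Ω) {V : Euc n → Euc n}
    {U : Euc n → Euc n →L[ℝ] Euc n} (hV : ∀ x ∈ Ω, HasFDerivAt V (U x) x)
    (hs : ∀ x ∈ Ω, ∀ v w, ⟪U x v, w⟫ = ⟪U x w, v⟫) (hp : ∀ x ∈ Ω, ∀ v, 0 ≤ ⟪U x v, v⟫) {q : ℝ}
    (hq : ∀ x ∈ Ω, ∑ i, ⟪U x (EuclideanSpace.single i (1 : ℝ)), EuclideanSpace.single i 1⟫ ≤ q) :
    n * ((volume (V '' Ω)).toReal / (volume Ω).toReal) ^ ((1 : ℝ) / n) ≤ q := by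
  have hn0 : (0 : ℝ) < n := by exact_mod_cast hn
  have hq0 : 0 ≤ q := by
    obtain ⟨x, hx⟩ := hne
    exact (trace_nonneg (hp x hx)).trans (hq x hx)
  have hfin : volume Ω < ⊤ := hb.measure_lt_top
  have hpos : 0 < (volume Ω).toReal :=
    ENNReal.toReal_pos (hΩ.measure_pos volume hne).ne' hfin.ne
  have h1 : volume (V '' Ω) ≤ ENNReal.ofReal ((q / n) ^ n) * volume Ω := by
    refine (addHaar_image_le_lintegral_abs_det_fderiv volume hΩ.measurableSet
      fun x hx => (hV x hx).hasFDerivWithinAt).trans ?_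
    rw [← setLIntegral_const]
    refine setLIntegral_mono measurable_const fun x hx => ENNReal.ofReal_le_ofReal ?_
    refine (abs_det_le_trace_pow hn (hs x hx) (hp x hx)).trans ?_
    exact pow_le_pow_left₀ (div_nonneg (trace_nonneg (hp x hx)) hn0.le)
      (div_le_div_of_nonneg_right (hq x hx) hn0.le) n
  have h2 : (volume (V '' Ω)).toReal ≤ (q / n) ^ n * (volume Ω).toReal := by
    have := ENNReal.toReal_mono (ENNReal.mul_ne_top ENNReal.ofReal_ne_top hfin.ne) h1
    rwa [ENNReal.toReal_mul, ENNReal.toReal_ofReal (by positivity)] at this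
  have h3 : (volume (V '' Ω)).toReal / (volume Ω).toReal ≤ (q / n) ^ n := by
    rwa [div_le_iff₀ hpos]
  have h4 := Real.rpow_le_rpow (by positivity) h3 (by positivity : (0 : ℝ) ≤ 1 / n)
  rw [one_div, Real.pow_rpow_inv_natCast (by positivity) hn.ne'] at h4
  rw [one_div]
  calc _ ≤ n * (q / n) := by gcongr
    _ = q := by field_simp

/-- A function with gradient bounded by one has a point of bounded Hessian. -/
lemma exists_inner_self_le {E : Type*} [NormedAddCommGroup E] [InnerProductSpace ℝ E]
    [FiniteDimensional ℝ E] {Ω : Set E} {u : E → ℝ} {V : E → E} {U : E → E →L[ℝ] E}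
    {x₀ : E} {ρ : ℝ} (hρ : 0 < ρ) (hball : Metric.closedBall x₀ ρ ⊆ Ω)
    (hu : ∀ x ∈ Ω, HasFDerivAt u (innerSL ℝ (V x)) x) (hV : ∀ x ∈ Ω, HasFDerivAt V (U x) x)
    (hV1 : ∀ x ∈ Ω, ‖V x‖ ≤ 1) :
    ∃ x ∈ Ω, ∀ v, ⟪U x v, v⟫ ≤ 4 / ρ * ‖v‖ ^ 2 := by
  set μ := 4 / ρ with hμ
  set φ : E → ℝ := fun x => u x - μ / 2 * ‖x - x₀‖ ^ 2 with hφ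
  have hφ1 : ∀ x ∈ Ω, HasFDerivAt φ (innerSL ℝ (V x) - μ • innerSL ℝ (x - x₀)) x := fun x hx => by
    have h1 : HasFDerivAt (fun x => ‖x - x₀‖ ^ 2) (2 • (innerSL ℝ (x - x₀)).comp
        (ContinuousLinearMap.id ℝ E)) x := ((hasFDerivAt_id x).sub_const x₀).norm_sq
    refine ((hu x hx).sub (h1.const_mul (μ / 2))).congr_fderiv ?_
    ext v
    simp
    ring
  have hx₀ : x₀ ∈ Metric.closedBall x₀ ρ := Metric.mem_closedBall_self hρ.le
  obtain ⟨x, hx, hmax⟩ := (isCompact_closedBall x₀ ρ).exists_isMaxOn ⟨x₀, hx₀⟩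
    (fun z hz => (hφ1 z (hball hz)).continuousAt.continuousWithinAt)
  have hlip : u x - u x₀ ≤ ‖x - x₀‖ := by
    have := (convex_closedBall x₀ ρ).norm_image_sub_le_of_norm_hasFDerivWithin_le (C := 1)
      (fun z hz => (hu z (hball hz)).hasFDerivWithinAt)
      (fun z hz => by rw [innerSL_apply_norm]; exact hV1 z (hball hz)) hx₀ hx
    rw [one_mul] at this
    exact (le_abs_self _).trans this
  have hxρ : ‖x - x₀‖ < ρ := by
    have h1 : φ x₀ ≤ φ x := hmax hx₀
    simp only [hφ, sub_self, norm_zero] at h1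
    by_contra hcon
    have h2 : ‖x - x₀‖ = ρ := le_antisymm (by simpa [dist_eq_norm] using hx) (not_lt.1 hcon)
    rw [h2] at h1 hlip
    have h3 : μ / 2 * ρ ^ 2 = 2 * ρ := by rw [hμ]; field_simp; norm_num
    rw [h3] at h1
    norm_num at h1
    linarith
  have hnhds : Metric.ball x₀ ρ ∈ 𝓝 x :=
    Metric.isOpen_ball.mem_nhds (by rwa [Metric.mem_ball, dist_eq_norm])
  have hloc : IsLocalMax φ x :=
    hmax.isLocalMax (Filter.mem_of_superset hnhds Metric.ball_subset_closedBall)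
  refine ⟨x, hball hx, fun v => ?_⟩
  have h2 : HasFDerivAt (fun x => innerSL ℝ (V x) - μ • innerSL ℝ (x - x₀))
      ((innerSL ℝ : E →L[ℝ] E →L[ℝ] ℝ).comp (U x) - μ • (innerSL ℝ : E →L[ℝ] E →L[ℝ] ℝ)) x := by
    have e1 : HasFDerivAt (fun x => innerSL ℝ (V x))
        ((innerSL ℝ : E →L[ℝ] E →L[ℝ] ℝ).comp (U x)) x :=
      (innerSL ℝ : E →L[ℝ] E →L[ℝ] ℝ).hasFDerivAt.comp x (hV x (hball hx))
    have e2 : HasFDerivAt (fun x => innerSL ℝ (x - x₀)) (innerSL ℝ : E →L[ℝ] E →L[ℝ] ℝ) x :=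
      (innerSL ℝ : E →L[ℝ] E →L[ℝ] ℝ).hasFDerivAt.comp x ((hasFDerivAt_id x).sub_const x₀)
    exact e1.sub (e2.const_smul μ)
  have h3 := hloc.second_fderiv_nonpos (Filter.eventually_of_mem hnhds
    fun z hz => hφ1 z (hball (Metric.ball_subset_closedBall hz))) h2 v
  simp only [_root_.sub_apply, _root_.smul_apply, ContinuousLinearMap.comp_apply,
    innerSL_apply_apply, smul_eq_mul] at h3
  have h4 : innerSL ℝ v v = ‖v‖ ^ 2 := by simp
  rw [h4] at h3
  linarith

end SolutionBounds

section DataBounds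

set_option maxSynthPendingDepth 5

variable {E : Type*} [NormedAddCommGroup E] [NormedSpace ℝ E] {f : E × E → ℝ} {x p : E}

lemma norm_fderiv_fderiv_eq {V W : Type*} [NormedAddCommGroup V] [NormedSpace ℝ V]
    [NormedAddCommGroup W] [NormedSpace ℝ W] (F : V → W) (z : V) :
    ‖fderiv ℝ (fderiv ℝ F) z‖ = ‖iteratedFDeriv ℝ 2 F z‖ := by
  rw [← norm_iteratedFDeriv_one, norm_iteratedFDeriv_fderiv]

lemma fderiv_partial_left (hf : DifferentiableAt ℝ f (x, p)) :
    fderiv ℝ (fun x' => f (x', p)) x =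
      (fderiv ℝ f (x, p)).comp (ContinuousLinearMap.inl ℝ E E) :=
  (hf.hasFDerivAt.comp x (hasFDerivAt_prodMk_left x p)).fderiv

lemma fderiv_mixed_apply (hf : ContDiffAt ℝ 2 f (x, p)) (q a : E) :
    fderiv ℝ (fun p' => fderiv ℝ (fun x' => f (x', p')) x) p q a =
      fderiv ℝ (fderiv ℝ f) (x, p) (0, q) (a, 0) := by
  have hlim : Filter.Tendsto (fun p' : E => (x, p')) (𝓝 p) (𝓝 (x, p)) :=
    (Continuous.prodMk_right x).continuousAt
  have h1 : (fun p' => fderiv ℝ (fun x' => f (x', p')) x) =ᶠ[𝓝 p]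
      fun p' => (fderiv ℝ f (x, p')).comp (ContinuousLinearMap.inl ℝ E E) := by
    filter_upwards [hlim.eventually hf.eventually_hasFDerivAt] with p' hp'
    exact fderiv_partial_left hp'.differentiableAt
  have h2 : HasFDerivAt (fun p' => fderiv ℝ f (x, p'))
      ((fderiv ℝ (fderiv ℝ f) (x, p)).comp (ContinuousLinearMap.inr ℝ E E)) p :=
    hf.hasFDerivAt_fderiv.comp p (hasFDerivAt_prodMk_right x p)
  have h3 := h2.clm_comp (hasFDerivAt_const (ContinuousLinearMap.inl ℝ E E) p)
  rw [h1.fderiv_eq, h3.fderiv]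
  simp

lemma fderiv_mixed_le (hf : ContDiffAt ℝ 2 f (x, p)) {ε : ℝ}
    (h : ‖fderiv ℝ (fun p' => fderiv ℝ (fun x' => f (x', p')) x) p‖ ≤ ε) (q a : E) :
    fderiv ℝ (fderiv ℝ f) (x, p) (0, q) (a, 0) ≤ ε * ‖q‖ * ‖a‖ := by
  rw [← fderiv_mixed_apply hf]
  exact (le_abs_self _).trans (ContinuousLinearMap.le_of_opNorm_le _
    (ContinuousLinearMap.le_of_opNorm_le _ h q) a)

lemma fderiv_fderiv_left_nonpos {Ω : Set E} (hΩ : IsOpen Ω) (hx : x ∈ Ω)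
    (hf : ContDiffAt ℝ 2 f (x, p)) (hconc : ConcaveOn ℝ (closure Ω) (fun x => f (x, p))) (a : E) :
    fderiv ℝ (fderiv ℝ f) (x, p) (a, 0) (a, 0) ≤ 0 := by
  refine second_fderiv_nonpos_of_concave hf ?_
  have h1 : Filter.Tendsto (fun t : ℝ => x + t • a) (𝓝 0) (𝓝 x) := by
    have : Continuous fun t : ℝ => x + t • a := by fun_prop
    simpa using this.tendsto 0
  have h2 : Filter.Tendsto (fun t : ℝ => x - t • a) (𝓝 0) (𝓝 x) := by
    have : Continuous fun t : ℝ => x - t • a := by fun_prop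
    simpa using this.tendsto 0
  filter_upwards [h1.eventually (hΩ.mem_nhds hx), h2.eventually (hΩ.mem_nhds hx)] with t ht1 ht2
  have h3 := hconc.2 (subset_closure ht1) (subset_closure ht2) (by norm_num : (0 : ℝ) ≤ 1 / 2)
    (by norm_num : (0 : ℝ) ≤ 1 / 2) (by norm_num)
  have e : (1 / 2 : ℝ) • (x + t • a) + (1 / 2 : ℝ) • (x - t • a) = x := by module
  simp only [e, smul_eq_mul] at h3
  simp only [Prod.smul_mk, smul_zero, Prod.mk_add_mk, add_zero, Prod.mk_sub_mk, sub_zero]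
  linarith

end DataBounds

section MainTheorem

lemma volume_ratio_pos (hn : 0 < n) {Ω D : Set (Euc n)} (hΩ : IsOpen Ω) (hD : IsOpen D)
    (hΩb : Bornology.IsBounded Ω) (hDb : Bornology.IsBounded D) (hΩn : Ω.Nonempty)
    (hDn : D.Nonempty) :
    0 < ((n : ℝ) / 2) * ((volume D).toReal / (volume Ω).toReal) ^ ((1 : ℝ) / n) := by
  have h1 : 0 < (volume Ω).toReal :=
    ENNReal.toReal_pos (hΩ.measure_pos volume hΩn).ne' hΩb.measure_lt_top.ne
  have h2 : 0 < (volume D).toReal :=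
    ENNReal.toReal_pos (hD.measure_pos volume hDn).ne' hDb.measure_lt_top.ne
  have h3 : (0 : ℝ) < n := by exact_mod_cast hn
  positivity

/-- Bounds for the right-hand side and the Hessian of a solution. -/
lemma IsSmoothSol.bounds (hn : 0 < n) {Ω D : Set (Euc n)} {f : Euc n × Euc n → ℝ} {c K R ρ : ℝ}
    {u : Euc n → ℝ} {x₀ : Euc n} (hu : IsSmoothSol Ω D f c u) (hΩ : IsOpen Ω)
    (hΩb : Bornology.IsBounded Ω) (hosc : OSCcond Ω D f) (hK : C2Bound Ω D f K)
    (hR : ∀ y ∈ closure D, ∀ k : Option (Fin n), ‖minkField k y‖ ≤ R) (hρ : 0 < ρ)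
    (hball : Metric.closedBall x₀ ρ ⊆ Ω) :
    ∀ x ∈ Ω, f (x, gradient u x) + c = ∑ k, ⟪minkField k (gradient u x),
        fderiv ℝ (gradient u) x (minkField k (gradient u x))⟫ ∧
      ((n : ℝ) / 2) * ((volume D).toReal / (volume Ω).toReal) ^ ((1 : ℝ) / n) ≤
        f (x, gradient u x) + c ∧
      ∀ v, ‖fderiv ℝ (gradient u) x v‖ ≤
        (Fintype.card (Option (Fin n)) * (4 / ρ * R ^ 2) + 2 * K) * ‖v‖ := by
  obtain ⟨hsm, ⟨δ, hδ, hH⟩, hg1, heq, himg⟩ := hu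
  have hcl : ∀ x ∈ Ω, x ∈ closure Ω := fun x hx => subset_closure hx
  have hpd : ∀ x ∈ Ω, (Hess u x).PosDef := fun x hx => posDef_of_MatLE hδ (hH x (hcl x hx))
  have hd : ∀ x ∈ Ω, DifferentiableAt ℝ (gradient u) x := fun x hx =>
    differentiableAt_gradient_of_posDef hn (hpd x hx)
  have hs : ∀ x ∈ Ω, ∀ v w, ⟪fderiv ℝ (gradient u) x v, w⟫ = ⟪fderiv ℝ (gradient u) x w, v⟫ :=
    fun x hx => inner_fderiv_gradient_comm_of_isHermitian (hpd x hx).isHermitian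
  have hp : ∀ x ∈ Ω, ∀ v, 0 ≤ ⟪fderiv ℝ (gradient u) x v, v⟫ := fun x hx v => by
    rcases eq_or_ne v 0 with rfl | hv
    · simp
    · exact (inner_fderiv_gradient_pos_of_posDef (hpd x hx) hv).le
  have hgD : ∀ x ∈ Ω, gradient u x ∈ closure D := fun x hx =>
    subset_closure (himg ▸ mem_image_of_mem _ hx)
  have hG : ∀ x ∈ Ω, f (x, gradient u x) + c = ∑ k, ⟪minkField k (gradient u x),
      fderiv ℝ (gradient u) x (minkField k (gradient u x))⟫ := fun x hx => by
    rw [← heq x hx, minkDiv_eq (hd x hx) (hg1 x (hcl x hx))]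
  have htr : ∀ x ∈ Ω, ∑ i, ⟪fderiv ℝ (gradient u) x (EuclideanSpace.single i (1 : ℝ)),
      EuclideanSpace.single i 1⟫ ≤ f (x, gradient u x) + c := fun x hx => by
    rw [hG x hx]; exact trace_le_sum_minkField (hg1 x (hcl x hx)) (hp x hx)
  have hx₀ : x₀ ∈ Ω := hball (Metric.mem_closedBall_self hρ.le)
  obtain ⟨x₁, hx₁, hU₁⟩ := exists_inner_self_le (u := u) (V := gradient u)
    (U := fun x => fderiv ℝ (gradient u) x) hρ hball
    (fun x hx => by
      have h1 : DifferentiableAt ℝ u x := (hsm.contDiffAt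
        (Filter.mem_of_superset (hΩ.mem_nhds hx) subset_closure)).differentiableAt (by simp)
      exact h1.hasGradientAt.hasFDerivAt.congr_fderiv (by ext; simp))
    (fun x hx => (hd x hx).hasFDerivAt) (fun x hx => (hg1 x (hcl x hx)).le)
  have hup : ∀ x ∈ Ω, f (x, gradient u x) + c ≤
      Fintype.card (Option (Fin n)) * (4 / ρ * R ^ 2) + 2 * K := fun x hx => by
    have h1 : f (x₁, gradient u x₁) + c ≤ Fintype.card (Option (Fin n)) * (4 / ρ * R ^ 2) := by
      rw [hG x₁ hx₁]
      refine (Finset.sum_le_card_nsmul _ _ (4 / ρ * R ^ 2) fun k _ => ?_).trans (by simp)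
      rw [real_inner_comm]
      refine (hU₁ _).trans ?_
      gcongr
      exact hR _ (hgD x₁ hx₁) k
    have h2 := abs_le.1 (hK.2 (x, gradient u x) ⟨hcl x hx, hgD x hx⟩).1
    have h3 := abs_le.1 (hK.2 (x₁, gradient u x₁) ⟨hcl x₁ hx₁, hgD x₁ hx₁⟩).1
    linarith
  intro x hx
  refine ⟨hG x hx, ?_, ContinuousLinearMap.norm_apply_le_mul_of_inner_le (hs x hx) (hp x hx)
    fun v hv => (inner_self_le_trace (hs x hx) (hp x hx) hv).trans
      ((htr x hx).trans (hup x hx))⟩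
  have h1 := volume_ratio_le_of_trace_le hn hΩ ⟨x, hx⟩ hΩb
    (fun z hz => (hd z hz).hasFDerivAt) hs hp (q := f (x, gradient u x) + c +
      ((n : ℝ) / 2) * ((volume D).toReal / (volume Ω).toReal) ^ ((1 : ℝ) / n)) (fun z hz => by
      have := (abs_le.1 (hosc z (hcl z hz) x (hcl x hx) _ (hgD z hz) _ (hgD x hx))).2
      linarith [htr z hz])
  rw [himg] at h1
  linarith

lemma quadSup_le (hn : 0 < n) {u : Euc n → ℝ} {y : Euc n} {C : ℝ}
    (h : ∀ e : Euc n, ‖e‖ ≤ 1 → ⟪fderiv ℝ (gradient u) y e, e⟫ ≤ C) : quadSup (Hess u y) ≤ C := by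
  have : Nonempty (Metric.sphere (0 : Euc n) 1) :=
    ⟨⟨EuclideanSpace.single (⟨0, hn⟩ : Fin n) (1 : ℝ), by simp⟩⟩
  refine ciSup_le fun ξ => ?_
  rw [dotProduct_Hess_mulVec]
  exact h _ (mem_sphere_zero_iff_norm.1 ξ.2).le

end MainTheorem

theorem statement_18 {n : ℕ} (hn : 2 ≤ n)
    (Ω Ωt : Set (Euc n)) (ht h : Euc n → ℝ) (θt θ : ℝ)
    (hdom : DomainSetup Ω Ωt ht h θt θ)
    (hball : closure Ωt ⊆ Metric.ball (0 : Euc n) 1)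
    :
    ∀ K : ℝ, 0 < K →
      ∃ ε C₃₅ : ℝ, 0 < ε ∧ 0 < C₃₅ ∧
        ∀ f : Euc n × Euc n → ℝ, InA Ω Ωt f → C2Bound Ω Ωt f K → OSCcond Ω Ωt f →
          DxBound Ω Ωt f ε → DxpBound Ω Ωt f ε →
        ∀ (c : ℝ) (u ut : Euc n → ℝ), IsSmoothSol Ω Ωt f c u → IsLegendre Ω Ωt u ut →
        ∀ y ∈ closure Ωt, quadSup (Hess ut y) ≤ C₃₅ := by
  obtain ⟨hΩo, hDo, hΩb, hDb, hΩn, hDn, hts, hs, hΩe, hDe, hΩN, hDN, hθt, hθ, hΩH, hDH⟩ := hdom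
  have hn0 : 0 < n := by omega
  have : Nontrivial (Euc n) :=
    ⟨⟨EuclideanSpace.single (⟨0, hn0⟩ : Fin n) (1 : ℝ), 0, by simp⟩⟩
  intro K hK
  have hΩc := convexDomain_of_hess hΩb hΩn hts hΩe hΩN hθt hΩH
  have hDc := convexDomain_of_hess hDb hDn hs hDe hDN hθ hDH
  obtain ⟨R, hR1, hR⟩ := exists_minkField_bound hDb hball
  obtain ⟨x₀, hx₀⟩ := hΩn
  obtain ⟨ρ, hρ, hρΩ⟩ := Metric.nhds_basis_closedBall.mem_iff.1 (hΩo.mem_nhds hx₀)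
  have hR0 : 0 < R := by linarith
  set a₀ := ((n : ℝ) / 2) * ((volume Ωt).toReal / (volume Ω).toReal) ^ ((1 : ℝ) / n) with ha₀
  have ha₀pos : 0 < a₀ := volume_ratio_pos hn0 hΩo hDo hΩb hDb ⟨x₀, hx₀⟩ hDn
  set Λ := Fintype.card (Option (Fin n)) * (4 / ρ * R ^ 2) + 2 * K with hΛ
  have hΛ0 : 0 ≤ Λ := by positivity
  have hcard : (0 : ℝ) < Fintype.card (Option (Fin n)) := by exact_mod_cast Fintype.card_pos
  obtain ⟨ε, C, hε, -, hC, hmain⟩ := DualSolution.exists_bound (ι := Option (Fin n))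
    (l := (a₀ / R) ^ 2 / Fintype.card (Option (Fin n))) (Cb := Λ * R) (Cr := R)
    (C₁ := K + 2 * (Fintype.card (Option (Fin n)) * (R * (Λ * R))))
    (C₂ := K + 2 * (Fintype.card (Option (Fin n)) * (R * (Λ * R)))) hΩc hDc
    (by positivity) (by positivity)
  refine ⟨ε, C, hε, hC, fun f hfA hf2 hosc hfx hfxp c u ut hu hut y hy => ?_⟩
  have hbd := hu.bounds hn0 hΩo hΩb hosc hf2 (fun y hy k => (hR y hy k).1) hρ hρΩ
  obtain ⟨-, ⟨δ, hδ, hH⟩, hg1, -, himg⟩ := hu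
  have L : LegendrePair Ω Ωt u ut :=
    ⟨hn0, hΩo, hDo, hΩb.isCompact_closure, hDc.convex, hDn,
      fun x hx => posDef_of_MatLE hδ (hH x hx), himg, hut.1, hut.2.2.1, hut.2.2.2⟩
  have hgg : ∀ y ∈ Ωt, gradient u (gradient ut y) = y := fun y hy =>
    (L.mem_closure (subset_closure hy)).2
  have hmem : ∀ y ∈ Ωt, (gradient ut y, y) ∈ closure Ω ×ˢ closure Ωt := fun y hy =>
    ⟨subset_closure (L.mem_left hy), subset_closure hy⟩
  have hfc : ∀ y ∈ Ωt, ContDiffAt ℝ 2 f (gradient ut y, y) := fun y hy =>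
    hf2.1.contDiffAt (Filter.mem_of_superset ((hΩo.prod hDo).mem_nhds ⟨L.mem_left hy, hy⟩)
      (prod_mono subset_closure subset_closure))
  have hFd : fderiv ℝ (fun z => f z + c) = fderiv ℝ f := funext fun z => fderiv_add_const c
  have hbd' := fun y (hy : y ∈ Ωt) => hbd _ (L.mem_left hy)
  refine quadSup_le hn0 (hmain (dualSolution_of_equation (ι := Option (Fin n)) (K := K) (R := R)
    (Λ := Λ) (a₀ := a₀) (F := fun z => f z + c) (r := minkField)
    (U := fun y => fderiv ℝ (gradient u) (gradient ut y)) hDo hR0 hΛ0 ha₀pos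
    (fun y hy => L.hasFDerivWithinAt_gradient hy) (fun y hy => L.hasFDerivWithinAt_hess hy)
    (fun y hy => L.differentiableAt_third hy) (fun y hy => L.symm_hess hy)
    (fun y hy v hv => inner_fderiv_gradient_pos_of_posDef (L.posDef_right hy) hv)
    (fun y hy => L.symm_third hy) (fun y hy => L.symm_third_inner hy) (fun y hy => L.mem_left hy)
    (fun y hy => L.mem_frontier_left hy) (fun y hy => (hfc y hy).add contDiffAt_const)
    ?_ ?_ ?_ ?_ ?_ ?_ ?_ ?_ ?_ (fun y hy => L.hess_apply_hess hy) ?_ ?_ ?_) y hy)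
  · exact fun y hy => hFd ▸ (hf2.2 _ (hmem y hy)).2.1
  · intro y hy
    rw [hFd, norm_fderiv_fderiv_eq]
    exact (hf2.2 _ (hmem y hy)).2.2
  · intro y hy
    rw [hFd, ← fderiv_partial_left ((hfc y hy).differentiableAt (by norm_num))]
    exact hfx _ (hmem y hy).1 _ (hmem y hy).2
  · intro y hy a
    rw [hFd]
    exact fderiv_fderiv_left_nonpos hΩo (L.mem_left hy) (hfc y hy) (hfA.2 y (hmem y hy).2) a
  · intro y hy p a
    rw [hFd]
    exact fderiv_mixed_le (hfc y hy) (hfxp _ (hmem y hy).1 _ (hmem y hy).2) p a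
  · intro y hy k
    refine (contDiffAt_minkField k ?_).of_le ENat.LEInfty.out
    simpa using hball (subset_closure hy)
  · exact fun y hy k => (hR y (subset_closure hy) k).1
  · exact fun y hy k => (hR y (subset_closure hy) k).2.1
  · exact fun y hy k => (hR y (subset_closure hy) k).2.2
  · exact fun y hy v => (hbd' y hy).2.2 v
  · intro y hy
    have := (hbd' y hy).1
    rwa [hgg y hy] at this
  · intro y hy
    have := (hbd' y hy).2.1
    rwa [hgg y hy] at this

end
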